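/- Let P be a centrally symmetric convex polygon in ℝ² with exactly 10 vertices (a centrally symmetric convex decagon). Then τ*(P) = 6 — i.e., P admits a six-fold lattice tiling of ℝ² but admits no k-fold lattice tiling for any positive integer k < 6 — if and only if there exists an invertible affine map T of ℝ² such that T(P) is centered at the origin and the set of edge midpoints of T(P) equals D₁ or equals D₂. -/

import Mathlib

open Set Pointwise

noncomputable section

/-- A point of the plane `ℝ²`. -/
abbrev Pt : Type := ℝ × ℝ

/-- The standard integer lattice `ℤ² ⊆ ℝ²`. -/
def IntLattice : Set Pt := {p : Pt | ∃ a b : ℤ, p = ((a : ℝ), (b : ℝ))}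

/-- A lattice in `ℝ²` is the image of `ℤ²` under an invertible linear map. -/
def IsLattice (L : Set Pt) : Prop :=
  ∃ B : Pt ≃ₗ[ℝ] Pt, L = B '' IntLattice

/-- `K + L` is a `k`-fold lattice tiling of the plane: `L` is a lattice, every point lies in
at least `k` translates `K + l` (`l ∈ L`), and every point lies in at most `k` translates
`interior K + l`. -/
def IsKFoldLatticeTiling (K L : Set Pt) (k : ℕ) : Prop :=
  IsLattice L ∧
  (∀ p : Pt, (k : ℕ∞) ≤ {l ∈ L | p - l ∈ K}.encard) ∧
  (∀ p : Pt, {l ∈ L | p - l ∈ interior K}.encard ≤ (k : ℕ∞))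

/-- A discrete multiset of points of the plane, given as a family `x : I → ℝ²`:
every bounded set contains `x i` for only finitely many indices. -/
def IsDiscreteFamily {I : Type} (x : I → Pt) : Prop :=
  ∀ B : Set Pt, Bornology.IsBounded B → {i : I | x i ∈ B}.Finite

/-- `K + X` is a `k`-fold translative tiling of the plane, for the discrete multiset
`X = (x i)_{i ∈ I}`: every point lies in `K + x i` for at least `k` indices, and in
`interior K + x i` for at most `k` indices. -/
def IsKFoldTranslativeTiling {I : Type} (K : Set Pt) (x : I → Pt) (k : ℕ) : Prop :=
  IsDiscreteFamily x ∧
  (∀ p : Pt, (k : ℕ∞) ≤ {i : I | p - x i ∈ K}.encard) ∧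
  (∀ p : Pt, {i : I | p - x i ∈ interior K}.encard ≤ (k : ℕ∞))

/-- A convex polygon with exactly `n` vertices: a compact convex set with nonempty interior
which is the convex hull of its finitely many (`n`) extreme points. -/
def IsConvexPolygon (P : Set Pt) (n : ℕ) : Prop :=
  Convex ℝ P ∧ IsCompact P ∧ (interior P).Nonempty ∧
  (Set.extremePoints ℝ P).Finite ∧ (Set.extremePoints ℝ P).ncard = n ∧
  P = convexHull ℝ (Set.extremePoints ℝ P)

/-- `[a, b]` is an edge of the polygon `P`: a nondegenerate segment which is an extreme
(face) subset of `P`. -/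
def IsEdgeOf (P : Set Pt) (a b : Pt) : Prop :=
  a ≠ b ∧ IsExtreme ℝ P (segment ℝ a b)

/-- The set of midpoints of the edges of `P`. -/
def edgeMidpoints (P : Set Pt) : Set Pt :=
  {u : Pt | ∃ a b : Pt, IsEdgeOf P a b ∧ u = midpoint ℝ a b}

/-- `P` is centrally symmetric (about some center `c`). -/
def CentrallySymmetric (P : Set Pt) : Prop :=
  ∃ c : Pt, ∀ x : Pt, x ∈ P ↔ c + c - x ∈ P

/-- `D` is a parallelogram. -/
def IsParallelogram (D : Set Pt) : Prop :=
  ∃ v a b : Pt, LinearIndependent ℝ ![a, b] ∧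
    D = convexHull ℝ ({v, v + a, v + b, v + a + b} : Set Pt)

/-- The octagon `P₈(α)`, with vertices `±(α−1, 2), ±(α, −2), ±(1−α, 0), ±(1+α, −1)`. -/
def P8 (α : ℝ) : Set Pt :=
  convexHull ℝ ({(α - 1, 2), (α, -2), (1 - α, 0), (1 + α, -1),
                 (1 - α, -2), (-α, 2), (α - 1, 0), (-(1 + α), 1)} : Set Pt)

/-- The ten points `D₁`. -/
def D1 : Set Pt :=
  {(-1, 1/2), (1/2, 1), (3/2, 1), (2, 1/2), (2, 0),
   (1, -1/2), (-1/2, -1), (-3/2, -1), (-2, -1/2), (-2, 0)}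

/-- The ten points `D₂`. -/
def D2 : Set Pt :=
  {(1/2, -1), (3/2, -1/2), (2, 0), (3/2, 1/2), (1/2, 1),
   (-1/2, 1), (-3/2, 1/2), (-2, 0), (-3/2, -1/2), (-1/2, -1)}

/-- The set `(1/2)Λ = {λ/2 : λ ∈ Λ}`. -/
def halfSet (L : Set Pt) : Set Pt := (fun l : Pt => (2⁻¹ : ℝ) • l) '' L

/-- A cyclic enumeration `v : ZMod n → ℝ²` of the vertices of a convex polygon `P` with `n`
vertices: `v` is injective, its range is the vertex set of `P`, and consecutive vertices are
joined by edges of `P`. -/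
def IsCyclicVertexEnum (P : Set Pt) (n : ℕ) (v : ZMod n → Pt) : Prop :=
  Function.Injective v ∧ Set.range v = Set.extremePoints ℝ P ∧
  ∀ i : ZMod n, IsEdgeOf P (v i) (v (i + 1))


section Part1
open Set Pointwise

/-- cross product -/
def cr (a b : Pt) : ℝ := a.1 * b.2 - a.2 * b.1

structure Dec (v : ZMod 10 → Pt) : Prop where
  opp : ∀ i, v (i + 5) = -v i
  ord1 : ∀ i, 0 < cr (v i) (v (i + 1))
  ord2 : ∀ i, 0 < cr (v i) (v (i + 2))
  ord3 : ∀ i, 0 < cr (v i) (v (i + 3))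
  ord4 : ∀ i, 0 < cr (v i) (v (i + 4))
  conv : ∀ i j, j ≠ i → j ≠ i + 1 → 0 < cr (v (i + 1) - v i) (v j - v i)

def DPoly (v : ZMod 10 → Pt) : Set Pt := {x | ∀ i, 0 ≤ cr (v (i + 1) - v i) (x - v i)}

lemma zmod10_cases (k : ZMod 10) : k = 0 ∨ k = 1 ∨ k = 2 ∨ k = 3 ∨ k = 4 ∨ k = 5 ∨ k = 6 ∨ k = 7 ∨
    k = 8 ∨ k = 9 := by
  revert k; decide

lemma cr_neg_left (a b : Pt) : cr (-a) b = - cr a b := by simp [cr]; ring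
lemma cr_neg_right (a b : Pt) : cr a (-b) = - cr a b := by simp [cr]; ring
lemma cr_swap (a b : Pt) : cr a b = - cr b a := by simp [cr]; ring
lemma cr_add_left (a b c : Pt) : cr (a + b) c = cr a c + cr b c := by simp [cr]; ring
lemma cr_add_right (a b c : Pt) : cr a (b + c) = cr a b + cr a c := by simp [cr]; ring
lemma cr_sub_left (a b c : Pt) : cr (a - b) c = cr a c - cr b c := by simp [cr]; ring
lemma cr_sub_right (a b c : Pt) : cr a (b - c) = cr a b - cr a c := by simp [cr]; ring
lemma cr_smul_left (t : ℝ) (a b : Pt) : cr (t • a) b = t * cr a b := by simp [cr]; ring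
lemma cr_smul_right (t : ℝ) (a b : Pt) : cr a (t • b) = t * cr a b := by simp [cr]; ring
lemma cr_self (a : Pt) : cr a a = 0 := by simp [cr]; ring

lemma cr_decomp (a b x : Pt) (h : cr a b ≠ 0) :
    x = (cr x b / cr a b) • a + (cr a x / cr a b) • b := by
  ext
  · simp only [Prod.fst_add, Prod.smul_fst, smul_eq_mul]
    field_simp; simp only [cr]; ring
  · simp only [Prod.snd_add, Prod.smul_snd, smul_eq_mul]
    field_simp; simp only [cr]; ring

section extr
variable {P : Set Pt}

lemma ext_sum (hc : Convex ℝ P) (h0 : (0 : Pt) ∈ P) {m a b : Pt} (hm : m ∈ extremePoints ℝ P)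
    (ha : a ∈ P) (hb : b ∈ P) {α β : ℝ} (hα : 0 < α) (hβ : 0 < β) (e : m = α • a + β • b)
    (hab : cr a b ≠ 0) : 1 < α + β := by
  by_contra hle
  push Not at hle
  have h1 : 0 < 1 - α := by linarith
  have hz : (β / (1 - α)) • b ∈ P := by
    have := hc hb h0 (a := β / (1 - α)) (b := 1 - β / (1 - α)) (by positivity)
      (by rw [sub_nonneg, div_le_one h1]; linarith) (by ring)
    simpa using this
  have hmem : m ∈ openSegment ℝ a ((β / (1 - α)) • b) := by
    refine ⟨α, 1 - α, hα, h1, by ring, ?_⟩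
    rw [e, smul_smul, mul_div_cancel₀ _ h1.ne']
  have hma : a = m := (mem_extremePoints.1 hm).2 a ha _ hz hmem |>.1
  apply hab
  have : cr a m = β * cr a b := by rw [e, cr_add_right, cr_smul_right, cr_smul_right, cr_self]; ring
  rw [← hma, cr_self] at this
  rcases mul_eq_zero.1 this.symm with h | h
  · exact absurd h hβ.ne'
  · exact h

lemma ext_triple (hc : Convex ℝ P) (h0 : (0 : Pt) ∈ P) {a m b : Pt} (hm : m ∈ extremePoints ℝ P)
    (ha : a ∈ P) (hb : b ∈ P) (h1 : 0 < cr a m) (h2 : 0 < cr m b) (h3 : 0 < cr a b) :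
    cr a b < cr a m + cr m b := by
  have := ext_sum hc h0 hm ha hb (div_pos h2 h3) (div_pos h1 h3) (cr_decomp a b m h3.ne') h3.ne'
  rw [← add_div, lt_div_iff₀ h3] at this
  linarith

lemma ext_ne_smul (h0 : (0 : Pt) ∈ P) {y x : Pt} (hy : y ∈ extremePoints ℝ P)
    (hx : x ∈ P) (hy0 : y ≠ 0) {c : ℝ} (hc0 : 0 < c) (hc1 : c < 1) : y ≠ c • x := by
  intro e
  have hmem : y ∈ openSegment ℝ (0 : Pt) x := ⟨1 - c, c, by linarith, hc0, by ring, by simp [e]⟩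
  exact hy0 ((mem_extremePoints.1 hy).2 0 h0 x hx hmem).1.symm

lemma ext_neg (hs : ∀ x, x ∈ P → -x ∈ P) {x : Pt} (hx : x ∈ extremePoints ℝ P) :
    -x ∈ extremePoints ℝ P := by
  rw [mem_extremePoints] at hx ⊢
  refine ⟨hs _ hx.1, fun a ha b hb hab => ?_⟩
  have : x ∈ openSegment ℝ (-a) (-b) := by
    obtain ⟨s, t, hs, ht, h, e⟩ := hab
    refine ⟨s, t, hs, ht, h, ?_⟩
    rw [smul_neg, smul_neg, ← neg_add, e, neg_neg]
  obtain ⟨h1, h2⟩ := hx.2 (-a) (hs a ha) (-b) (hs b hb) this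
  exact ⟨by rw [← h1, neg_neg], by rw [← h2, neg_neg]⟩

lemma ext_collinear (h0 : (0 : Pt) ∈ P) (hs : ∀ x, x ∈ P → -x ∈ P) {x y : Pt}
    (hx : x ∈ extremePoints ℝ P) (hy : y ∈ extremePoints ℝ P) (hx0 : x ≠ 0) (hy0 : y ≠ 0)
    (h : cr x y = 0) : y = x ∨ y = -x := by
  have : ∃ c : ℝ, y = c • x := by
    by_cases h1 : x.1 = 0
    · have h2 : x.2 ≠ 0 := fun h2 => hx0 (Prod.ext h1 h2)
      refine ⟨y.2 / x.2, ?_⟩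
      have : y.1 = 0 := by
        simp only [cr, h1] at h
        have : x.2 * y.1 = 0 := by linarith
        exact (mul_eq_zero.1 this).resolve_left h2
      ext
      · simp [h1, this]
      · simp [h2]
    · refine ⟨y.1 / x.1, ?_⟩
      ext
      · simp [h1]
      · simp only [Prod.smul_snd, smul_eq_mul]
        field_simp
        simp only [cr] at h; linarith
  obtain ⟨c, hc⟩ := this
  have hc0 : c ≠ 0 := by rintro rfl; exact hy0 (by simpa using hc)
  have key : ∀ z ∈ extremePoints ℝ P, z ≠ 0 → ∀ d : ℝ, 0 < d → y = d • z → y = z := by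
    intro z hz hz0 d hd e
    rcases lt_trichotomy d 1 with h | h | h
    · exact absurd e (ext_ne_smul h0 hy hz.1 hy0 hd h)
    · simpa [h] using e
    · exfalso
      refine ext_ne_smul h0 hz hy.1 hz0 (c := d⁻¹) (by positivity) (inv_lt_one_of_one_lt₀ h) ?_
      rw [e, smul_smul, inv_mul_cancel₀ hd.ne', one_smul]
  rcases lt_or_gt_of_ne hc0 with h | h
  · right
    exact key (-x) (ext_neg hs hx) (by simpa using hx0) (-c) (by linarith) (by simpa using hc)
  · left; exact key x hx hx0 c h hc

end extr

lemma exists_five (E : Finset Pt) (hcard : E.card = 10) (hneg : ∀ x ∈ E, -x ∈ E)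
    (h0 : (0 : Pt) ∉ E) (hcol : ∀ x ∈ E, ∀ y ∈ E, cr x y = 0 → y = x ∨ y = -x) :
    ∃ y : Fin 5 → Pt, (∀ i j, i < j → 0 < cr (y i) (y j)) ∧
      ∀ x, x ∈ E ↔ (∃ i, x = y i) ∨ ∃ i, x = - y i := by
  classical
  obtain ⟨t, ht⟩ : ∃ t : ℝ, ∀ x ∈ E, x.1 + t * x.2 ≠ 0 := by
    obtain ⟨t, ht⟩ := Infinite.exists_notMem_finset (E.image (fun x : Pt => - x.1 / x.2))
    refine ⟨t, fun x hx h => ?_⟩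
    by_cases h2 : x.2 = 0
    · apply h0
      have : x = 0 := Prod.ext (by simpa [h2] using h) h2
      rwa [← this]
    · apply ht
      rw [Finset.mem_image]
      refine ⟨x, hx, ?_⟩
      field_simp; linarith
  set φ : Pt → ℝ := fun x => x.1 + t * x.2 with hφ
  have φneg : ∀ x, φ (-x) = - φ x := by intro x; simp [hφ]; ring
  set F := E.filter (fun x => 0 < φ x) with hF
  have hFn : E.filter (fun x => ¬ 0 < φ x) = F.image (fun x => -x) := by
    ext x
    simp only [Finset.mem_filter, Finset.mem_image, hF]
    constructor
    · rintro ⟨hx, hp⟩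
      refine ⟨-x, ⟨hneg x hx, ?_⟩, neg_neg x⟩
      rw [φneg]
      have := ht x hx
      have := lt_of_le_of_ne (not_lt.1 hp) this
      linarith
    · rintro ⟨y, ⟨hy, hp⟩, rfl⟩
      exact ⟨hneg y hy, by rw [φneg]; linarith⟩
  have hFc : F.card = 5 := by
    have h1 := Finset.card_filter_add_card_filter_not (s := E) (fun x => 0 < φ x)
    rw [hFn, Finset.card_image_of_injective _ neg_injective, hcard] at h1
    simp only [← hF] at h1
    omega
  have hcr : ∀ x ∈ F, ∀ y ∈ F, cr x y = φ x * φ y * (y.2 / φ y - x.2 / φ x) := by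
    intro x hx y hy
    have h1 := (Finset.mem_filter.1 hx).2
    have h2 := (Finset.mem_filter.1 hy).2
    field_simp
    simp only [cr, hφ]; ring
  have hinj : Set.InjOn (fun x : Pt => x.2 / φ x) F := by
    intro x hx y hy e
    have := hcr x hx y hy
    simp only at e
    rw [e, sub_self, mul_zero] at this
    rcases hcol x (Finset.mem_filter.1 hx).1 y (Finset.mem_filter.1 hy).1 this with h | h
    · exact h.symm
    · exfalso
      have h1 := (Finset.mem_filter.1 hx).2
      have h2 := (Finset.mem_filter.1 hy).2
      rw [h, φneg] at h2; linarith
  have hGc : (F.image (fun x : Pt => x.2 / φ x)).card = 5 := by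
    rw [Finset.card_image_of_injOn hinj, hFc]
  set emb := (F.image (fun x : Pt => x.2 / φ x)).orderEmbOfFin hGc with hemb
  have hm : ∀ i, ∃ x ∈ F, x.2 / φ x = emb i := by
    intro i
    have := Finset.orderEmbOfFin_mem _ hGc i
    exact Finset.mem_image.1 this
  choose y hyF hye using hm
  have hFy : ∀ x ∈ F, ∃ i, x = y i := by
    intro x hx
    have : x.2 / φ x ∈ Set.range emb := by
      rw [hemb, Finset.range_orderEmbOfFin]
      simp only [Finset.coe_image]
      exact ⟨x, hx, rfl⟩
    obtain ⟨i, hi⟩ := this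
    exact ⟨i, hinj hx (hyF i) (by simp only; rw [hye, hi])⟩
  refine ⟨y, fun i j hij => ?_, fun x => ⟨fun hx => ?_, ?_⟩⟩
  · rw [hcr _ (hyF i) _ (hyF j), hye, hye]
    have h1 := (Finset.mem_filter.1 (hyF i)).2
    have h2 := (Finset.mem_filter.1 (hyF j)).2
    have : emb i < emb j := emb.strictMono hij
    exact mul_pos (mul_pos h1 h2) (by linarith)
  · by_cases hp : 0 < φ x
    · exact Or.inl (hFy x (Finset.mem_filter.2 ⟨hx, hp⟩))
    · right
      have : x ∈ F.image (fun x => -x) := by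
        rw [← hFn]; exact Finset.mem_filter.2 ⟨hx, hp⟩
      obtain ⟨z, hz, rfl⟩ := Finset.mem_image.1 this
      obtain ⟨i, rfl⟩ := hFy z hz
      exact ⟨i, rfl⟩
  · rintro (⟨i, rfl⟩ | ⟨i, rfl⟩)
    · exact (Finset.mem_filter.1 (hyF i)).1
    · exact hneg _ (Finset.mem_filter.1 (hyF i)).1

end Part1

section Part2
open Set Pointwise

lemma dec_of_ext {P : Set Pt} (hc : Convex ℝ P) (h0 : (0 : Pt) ∈ P)
    (v : ZMod 10 → Pt) (hv : ∀ i, v i ∈ extremePoints ℝ P)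
    (opp : ∀ i, v (i + 5) = -v i)
    (ord1 : ∀ i, 0 < cr (v i) (v (i + 1)))
    (ord2 : ∀ i, 0 < cr (v i) (v (i + 2)))
    (ord3 : ∀ i, 0 < cr (v i) (v (i + 3)))
    (ord4 : ∀ i, 0 < cr (v i) (v (i + 4))) : Dec v := by
  refine ⟨opp, ord1, ord2, ord3, ord4, ?_⟩
  intro i j hj hj1
  have e2 : i + 1 + 1 = i + 2 := by ring
  have e3 : i + 1 + 2 = i + 3 := by ring
  have e4 : i + 1 + 3 = i + 4 := by ring
  have e6 : i + 1 + 5 = i + 6 := by ring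
  have h10 : (10 : ZMod 10) = 0 := rfl
  have f7 : i + 7 + 3 = i := by linear_combination h10
  have g7 : i + 7 + 4 = i + 1 := by linear_combination h10
  have f8 : i + 8 + 2 = i := by linear_combination h10
  have g8 : i + 8 + 3 = i + 1 := by linear_combination h10
  have f9 : i + 9 + 1 = i := by linear_combination h10
  have g9 : i + 9 + 2 = i + 1 := by linear_combination h10
  have hd : ∀ b, cr (v (i+1) - v i) (b - v i) = cr (v i) (v (i+1)) + cr (v (i+1)) b - cr (v i) b := by
    intro b; simp only [cr, Prod.fst_sub, Prod.snd_sub]; ring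
  rw [hd]
  have hT := fun a m b h1 h2 h3 => ext_triple (a := v a) (m := v m) (b := v b) hc h0 (hv m) (hv a).1 (hv b).1 h1 h2 h3
  have o1 := ord1 i
  obtain ⟨k, rfl⟩ : ∃ k, j = i + k := ⟨j - i, by ring⟩
  rcases zmod10_cases k with h|h|h|h|h|h|h|h|h|h <;> subst h
  · simp at hj
  · simp at hj1
  · have := hT i (i+1) (i+2) (ord1 i) (by have := ord1 (i+1); rwa [e2] at this) (ord2 i)
    linarith
  · have := hT i (i+1) (i+3) (ord1 i) (by have := ord2 (i+1); rwa [e3] at this) (ord3 i)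
    linarith
  · have := hT i (i+1) (i+4) (ord1 i) (by have := ord3 (i+1); rwa [e4] at this) (ord4 i)
    linarith
  · rw [opp, cr_neg_right, cr_neg_right, cr_self, cr_swap (v (i+1))]; linarith
  · rw [← e6, opp, cr_neg_right, cr_neg_right, cr_self]; linarith
  · have h3 := ord3 (i+7); rw [f7] at h3
    have h4 := ord4 (i+7); rw [g7] at h4
    have := hT (i+7) i (i+1) h3 (ord1 i) h4
    rw [cr_swap (v (i+1)), cr_swap (v i) (v (i+7))]; linarith
  · have h3 := ord2 (i+8); rw [f8] at h3
    have h4 := ord3 (i+8); rw [g8] at h4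
    have := hT (i+8) i (i+1) h3 (ord1 i) h4
    rw [cr_swap (v (i+1)), cr_swap (v i) (v (i+8))]; linarith
  · have h3 := ord1 (i+9); rw [f9] at h3
    have h4 := ord2 (i+9); rw [g9] at h4
    have := hT (i+9) i (i+1) h3 (ord1 i) h4
    rw [cr_swap (v (i+1)), cr_swap (v i) (v (i+9))]; linarith

namespace Dec
variable {v : ZMod 10 → Pt}

lemma hd (v : ZMod 10 → Pt) (i : ZMod 10) (b : Pt) : cr (v (i+1) - v i) (b - v i) =
    cr (v i) (v (i+1)) + cr (v (i+1)) b - cr (v i) b := by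
  simp only [cr, Prod.fst_sub, Prod.snd_sub]; ring

lemma mem_poly (H : Dec v) (j : ZMod 10) : v j ∈ DPoly v := by
  intro i
  by_cases h1 : j = i
  · subst h1; simp [cr]
  by_cases h2 : j = i + 1
  · subst h2; rw [cr_self]
  exact (H.conv i j h1 h2).le

/-- every vector lies in one of the cones -/
lemma cone (H : Dec v) (x : Pt) : ∃ i, 0 ≤ cr (v i) x ∧ 0 ≤ cr x (v (i + 1)) := by
  have key : ∀ i, 0 ≤ cr (v i) x → ∃ i, 0 ≤ cr (v i) x ∧ 0 ≤ cr x (v (i + 1)) := by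
    intro i hi
    by_contra hcon
    push Not at hcon
    have step : ∀ j, 0 ≤ cr (v j) x → 0 ≤ cr (v (j+1)) x := by
      intro j hj
      have := hcon j hj
      rw [cr_swap] at this; linarith
    have stepneg := hcon
    have h5 := step _ (step _ (step _ (step _ hi)))
    have h6 := hcon _ h5
    have e : i + 1 + 1 + 1 + 1 + 1 = i + 5 := by ring
    rw [e, H.opp, cr_neg_right, cr_swap] at h6
    linarith
  rcases le_total 0 (cr (v 0) x) with h | h
  · exact key 0 h
  · refine key (0 + 5) ?_
    rw [H.opp, cr_neg_left]; linarith

lemma coord (H : Dec v) (i : ZMod 10) (x : Pt) :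
    x = (cr x (v (i+1)) / cr (v i) (v (i+1))) • v i + (cr (v i) x / cr (v i) (v (i+1))) • v (i+1) :=
  cr_decomp _ _ _ (H.ord1 i).ne'

lemma convex_poly (v : ZMod 10 → Pt) : Convex ℝ (DPoly v) := by
  intro x hx y hy a b ha hb hab i
  have e : a • x + b • y - v i = a • (x - v i) + b • (y - v i) := by
    rw [smul_sub, smul_sub]
    have : v i = a • v i + b • v i := by rw [← add_smul, hab, one_smul]
    nth_rewrite 1 [this]
    abel
  rw [e, cr_add_right, cr_smul_right, cr_smul_right]
  have := hx i
  have := hy i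
  positivity

lemma poly_eq (H : Dec v) : DPoly v = convexHull ℝ (Set.range v) := by
  apply subset_antisymm
  · intro x hx
    obtain ⟨i, h1, h2⟩ := H.cone x
    have hi := hx i
    rw [hd] at hi
    have h0 : (0 : Pt) ∈ convexHull ℝ (range v) := by
      have a := subset_convexHull ℝ (range v) (mem_range_self i)
      have b := subset_convexHull ℝ (range v) (mem_range_self (i+5))
      have := (convex_convexHull ℝ (range v)) a b (a := 1/2) (b := 1/2) (by norm_num) (by norm_num) (by norm_num)
      rw [H.opp] at this
      simpa using this
    have a := subset_convexHull ℝ (range v) (mem_range_self i)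
    have b := subset_convexHull ℝ (range v) (mem_range_self (i+1))
    rw [H.coord i x]
    have hp := H.ord1 i
    set α := cr x (v (i+1)) / cr (v i) (v (i+1))
    set β := cr (v i) x / cr (v i) (v (i+1))
    have hα : 0 ≤ α := div_nonneg h2 hp.le
    have hβ : 0 ≤ β := div_nonneg h1 hp.le
    have hs : α + β ≤ 1 := by
      rw [← add_div, div_le_one hp, cr_swap x]; linarith
    have := (convex_convexHull ℝ (range v)).sum_mem (t := Finset.univ) (w := ![α, β, 1 - α - β])
      (z := ![v i, v (i+1), 0]) (by intro j _; fin_cases j <;> simp <;> linarith)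
      (by simp [Fin.sum_univ_three])
      (by intro j _; fin_cases j <;> simp [a, b, h0])
    simpa [Fin.sum_univ_three] using this
  · apply convexHull_min _ (convex_poly v)
    rintro _ ⟨j, rfl⟩
    exact H.mem_poly j

end Dec

lemma exists_dec {P : Set Pt} (hP : IsConvexPolygon P 10) (hs : P = -P) :
    ∃ v, Dec v ∧ P = DPoly v ∧ extremePoints ℝ P = range v := by
  obtain ⟨hc, hcomp, hIntr, hfin, hcard, hhull⟩ := hP
  have hs' : ∀ x, x ∈ P → -x ∈ P := by
    intro x hx; rw [hs] at hx; simpa using hx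
  have hEne : (extremePoints ℝ P).Nonempty := by
    apply nonempty_of_ncard_ne_zero; omega
  obtain ⟨x0, hx0⟩ := hEne
  have h0 : (0 : Pt) ∈ P := by
    have := hc hx0.1 (hs' _ hx0.1) (a := 1/2) (b := 1/2) (by norm_num) (by norm_num) (by norm_num)
    simpa using this
  have h0E : (0 : Pt) ∉ extremePoints ℝ P := by
    intro h
    have : extremePoints ℝ P ⊆ {0} := by
      intro y hy
      have := (mem_extremePoints.1 h).2 y hy.1 (-y) (hs' y hy.1)
        ⟨1/2, 1/2, by norm_num, by norm_num, by norm_num, by simp⟩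
      exact this.1
    have := ncard_le_ncard this
    simp at this; omega
  obtain ⟨y, hy1, hy2⟩ := exists_five hfin.toFinset
    (by rw [← ncard_eq_toFinset_card _ hfin]; exact hcard)
    (by intro x hx; simp only [Finite.mem_toFinset] at hx ⊢; exact ext_neg hs' hx)
    (by simpa using h0E)
    (by
      intro x hx y hy h
      simp only [Finite.mem_toFinset] at hx hy
      exact ext_collinear h0 hs' hx hy (fun h => h0E (h ▸ hx)) (fun h => h0E (h ▸ hy)) h)
  simp only [Finite.mem_toFinset] at hy2
  let v : ZMod 10 → Pt := (![y 0, y 1, y 2, y 3, y 4, -y 0, -y 1, -y 2, -y 3, -y 4] : Fin 10 → Pt)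
  have hmem : ∀ i, v i ∈ extremePoints ℝ P := by
    intro i
    rw [hy2]
    rcases zmod10_cases i with h|h|h|h|h|h|h|h|h|h <;> subst h
    · exact Or.inl ⟨0, rfl⟩
    · exact Or.inl ⟨1, rfl⟩
    · exact Or.inl ⟨2, rfl⟩
    · exact Or.inl ⟨3, rfl⟩
    · exact Or.inl ⟨4, rfl⟩
    · exact Or.inr ⟨0, rfl⟩
    · exact Or.inr ⟨1, rfl⟩
    · exact Or.inr ⟨2, rfl⟩
    · exact Or.inr ⟨3, rfl⟩
    · exact Or.inr ⟨4, rfl⟩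
  have hrange : extremePoints ℝ P = range v := by
    apply subset_antisymm
    · intro x hx
      rcases (hy2 x).1 hx with ⟨i, rfl⟩ | ⟨i, rfl⟩
      · fin_cases i
        · exact ⟨0, rfl⟩
        · exact ⟨1, rfl⟩
        · exact ⟨2, rfl⟩
        · exact ⟨3, rfl⟩
        · exact ⟨4, rfl⟩
      · fin_cases i
        · exact ⟨5, rfl⟩
        · exact ⟨6, rfl⟩
        · exact ⟨7, rfl⟩
        · exact ⟨8, rfl⟩
        · exact ⟨9, rfl⟩
    · rintro _ ⟨i, rfl⟩; exact hmem i
  have opp : ∀ i, v (i + 5) = -v i := by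
    intro i
    rcases zmod10_cases i with h|h|h|h|h|h|h|h|h|h <;> subst h
    · rfl
    · rfl
    · rfl
    · rfl
    · rfl
    · exact (neg_neg _).symm
    · exact (neg_neg _).symm
    · exact (neg_neg _).symm
    · exact (neg_neg _).symm
    · exact (neg_neg _).symm
  -- reduce order statements to i < 5
  have red : ∀ k : ZMod 10, (0 < cr (v 0) (v (0+k))) → (0 < cr (v 1) (v (1+k))) → (0 < cr (v 2) (v (2+k))) →
      (0 < cr (v 3) (v (3+k))) → (0 < cr (v 4) (v (4+k))) → ∀ i, 0 < cr (v i) (v (i + k)) := by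
    intro k a0 a1 a2 a3 a4 i
    have tr : ∀ j, 0 < cr (v j) (v (j + k)) → 0 < cr (v (j+5)) (v (j+5+k)) := by
      intro j h
      have e : j + 5 + k = j + k + 5 := by ring
      rw [e, opp, opp, cr_neg_left, cr_neg_right, neg_neg]; exact h
    rcases zmod10_cases i with h|h|h|h|h|h|h|h|h|h <;> subst h
    · exact a0
    · exact a1
    · exact a2
    · exact a3
    · exact a4
    · exact tr 0 a0
    · exact tr 1 a1
    · exact tr 2 a2
    · exact tr 3 a3
    · exact tr 4 a4
  have neg' : ∀ i j : Fin 5, i < j → 0 < cr (y j) (- y i) := by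
    intro i j h
    rw [cr_neg_right, cr_swap, neg_neg]; exact hy1 i j h
  have H : Dec v := by
    apply dec_of_ext hc h0 v hmem opp
    · apply red
      · exact hy1 0 1 (by decide)
      · exact hy1 1 2 (by decide)
      · exact hy1 2 3 (by decide)
      · exact hy1 3 4 (by decide)
      · exact neg' 0 4 (by decide)
    · apply red
      · exact hy1 0 2 (by decide)
      · exact hy1 1 3 (by decide)
      · exact hy1 2 4 (by decide)
      · exact neg' 0 3 (by decide)
      · exact neg' 1 4 (by decide)
    · apply red
      · exact hy1 0 3 (by decide)
      · exact hy1 1 4 (by decide)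
      · exact neg' 0 2 (by decide)
      · exact neg' 1 3 (by decide)
      · exact neg' 2 4 (by decide)
    · apply red
      · exact hy1 0 4 (by decide)
      · exact neg' 0 1 (by decide)
      · exact neg' 1 2 (by decide)
      · exact neg' 2 3 (by decide)
      · exact neg' 3 4 (by decide)
  refine ⟨v, H, ?_, hrange⟩
  rw [H.poly_eq, ← hrange]; exact hhull

end Part2

section Part3
open Set Pointwise

namespace Dec
variable {v : ZMod 10 → Pt}

/-- supporting function of edge `i` -/
def g (v : ZMod 10 → Pt) (i : ZMod 10) (x : Pt) : ℝ := cr (v (i + 1) - v i) (x - v i)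

lemma mem_iff (x : Pt) : x ∈ DPoly v ↔ ∀ i, 0 ≤ g v i x := Iff.rfl

lemma g_cont (v : ZMod 10 → Pt) (i : ZMod 10) : Continuous (g v i) := by
  unfold g cr; fun_prop

lemma g_comb (v : ZMod 10 → Pt) (i : ZMod 10) (a b : ℝ) (h : a + b = 1) (x y : Pt) :
    g v i (a • x + b • y) = a * g v i x + b * g v i y := by
  obtain rfl : b = 1 - a := by linarith
  simp only [g, cr, Prod.fst_sub, Prod.snd_sub, Prod.fst_add, Prod.snd_add, Prod.smul_fst, Prod.smul_snd, smul_eq_mul]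
  ring

lemma g_add (v : ZMod 10 → Pt) (i : ZMod 10) (x y : Pt) :
    g v i (x + y) = g v i x + cr (v (i + 1) - v i) y := by
  simp only [g, cr, Prod.fst_sub, Prod.snd_sub, Prod.fst_add, Prod.snd_add]
  ring

lemma g_self (v : ZMod 10 → Pt) (i : ZMod 10) : g v i (v i) = 0 := by simp [g, cr]
lemma g_self1 (v : ZMod 10 → Pt) (i : ZMod 10) : g v i (v (i + 1)) = 0 := by simp [g, cr_self]

lemma g_opp (H : Dec v) (i : ZMod 10) (x : Pt) : g v (i+5) (-x) = g v i x := by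
  have e : i + 5 + 1 = i + 1 + 5 := by ring
  simp only [g, e, H.opp]
  simp only [cr, Prod.fst_sub, Prod.snd_sub, Prod.fst_neg, Prod.snd_neg]; ring

lemma closed_poly (v : ZMod 10 → Pt) : IsClosed (DPoly v) := by
  have : DPoly v = ⋂ i, {x | 0 ≤ g v i x} := by ext x; simp [mem_iff]
  rw [this]
  exact isClosed_iInter fun i => isClosed_le continuous_const (g_cont v i)

lemma interior_poly (H : Dec v) : interior (DPoly v) = {x | ∀ i, 0 < g v i x} := by
  apply subset_antisymm
  · intro x hx i
    by_contra hn
    push Not at hn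
    have hc : ContinuousAt (fun t : ℝ => x + t • v i) 0 := by fun_prop
    have : ∀ᶠ t in nhds (0 : ℝ), x + t • v i ∈ interior (DPoly v) :=
      hc (by simpa using isOpen_interior.mem_nhds hx)
    obtain ⟨ε, hε, h⟩ := Metric.eventually_nhds_iff.1 this
    have h1 := interior_subset (h (y := ε/2) (by simp [abs_of_pos hε, hε])) i
    change 0 ≤ g v i _ at h1
    rw [g_add, cr_smul_right, cr_sub_left, cr_self, cr_swap] at h1
    have := H.ord1 i
    nlinarith
  · apply interior_maximal
    · intro x hx i; exact (hx i).le
    · have : {x | ∀ i, 0 < g v i x} = ⋂ i, {x | 0 < g v i x} := by ext x; simp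
      rw [this]
      exact isOpen_iInter_of_finite fun i => isOpen_lt continuous_const (g_cont v i)

lemma n2 (i : ZMod 10) : i + 1 + 1 ≠ i := by revert i; decide
lemma n1 (i : ZMod 10) : i + 1 + 1 ≠ i + 1 := by revert i; decide

lemma left_ext {a b : Pt} (hab : a ≠ b) : a ∈ extremePoints ℝ (segment ℝ a b) := by
  refine ⟨left_mem_segment ℝ a b, ?_⟩
  rintro x ⟨p, s, hp, hs, hps, rfl⟩ y ⟨q, t, hq, ht, hqt, rfl⟩ ⟨α, β, hα, hβ, hαβ, e⟩
  obtain rfl : p = 1 - s := by linarith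
  obtain rfl : q = 1 - t := by linarith
  obtain rfl : α = 1 - β := by linarith
  have h : ((1 - β) * s + β * t) • (b - a) = 0 := by
    have : ((1 - β) * s + β * t) • (b - a) =
      ((1 - β) • ((1 - s) • a + s • b) + β • ((1 - t) • a + t • b)) - a := by module
    rw [this, e, sub_self]
  rcases smul_eq_zero.1 h with h | h
  · have h1 := mul_nonneg hα.le hs
    have h2 := mul_nonneg hβ.le ht
    have : (1 - β) * s = 0 := by linarith
    have : s = 0 := (mul_eq_zero.1 this).resolve_left hα.ne'
    simp [this]
  · exact absurd (sub_eq_zero.1 h).symm hab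
lemma turn (H : Dec v) (i : ZMod 10) : 0 < cr (v (i+1) - v i) (v (i+1+1) - v (i+1)) := by
  have := H.conv i (i+1+1) (n2 i) (n1 i)
  simp only [cr, Prod.fst_sub, Prod.snd_sub] at this ⊢
  linarith

lemma face (H : Dec v) {i : ZMod 10} {x : Pt} (hx : x ∈ DPoly v) (h0 : g v i x = 0) :
    ∃ t : ℝ, 0 ≤ t ∧ t ≤ 1 ∧ x = v i + t • (v (i+1) - v i) := by
  have hcr : cr (v (i+1) - v i) (x - v i) = 0 := h0
  have ht1 := H.turn i
  have ht0 := H.turn (i - 1)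
  have e1 : i - 1 + 1 = i := by ring
  rw [e1] at ht0
  set e := v (i+1) - v i with he
  have hn : cr e (v (i+1+1) - v (i+1)) ≠ 0 := ht1.ne'
  have hdec := cr_decomp e (v (i+1+1) - v (i+1)) (x - v i) hn
  rw [hcr, zero_div, zero_smul, add_zero] at hdec
  set t := cr (x - v i) (v (i+1+1) - v (i+1)) / cr e (v (i+1+1) - v (i+1))
  refine ⟨t, ?_, ?_, ?_⟩
  · have h1 := hx (i-1)
    rw [e1] at h1
    have h2 : x - v (i-1) = (v i - v (i-1)) + t • e := by rw [← hdec]; abel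
    rw [h2, cr_add_right, cr_self, zero_add, cr_smul_right] at h1
    by_contra hneg
    push Not at hneg
    nlinarith
  · have h1 := hx (i+1)
    have h2 : x - v (i+1) = (t - 1) • e := by
      rw [sub_smul, one_smul, ← hdec, he]; abel
    rw [h2, cr_smul_right, cr_swap] at h1
    by_contra hneg
    push Not at hneg
    nlinarith
  · rw [← hdec]; abel

lemma g_edge_pos (H : Dec v) {i j : ZMod 10} (hij : j ≠ i) {t : ℝ} (h0 : 0 < t) (h1 : t < 1) :
    0 < g v j (v i + t • (v (i+1) - v i)) := by
  have e : v i + t • (v (i+1) - v i) = (1 - t) • v i + t • v (i+1) := by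
    rw [smul_sub, sub_smul, one_smul]; abel
  rw [e, g_comb _ _ _ _ (by ring)]
  have a := H.mem_poly i j
  have b := H.mem_poly (i+1) j
  change 0 ≤ g v j _ at a
  change 0 ≤ g v j _ at b
  by_cases h : i = j + 1
  · have : 0 < g v j (v (i+1)) := H.conv j (i+1) (by subst h; exact n2 j) (by subst h; exact n1 j)
    have := mul_pos h0 this
    have := mul_nonneg (by linarith : (0:ℝ) ≤ 1 - t) a
    linarith
  · have : 0 < g v j (v i) := H.conv j i (Ne.symm hij) h
    have := mul_pos (by linarith : (0:ℝ) < 1 - t) this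
    have := mul_nonneg h0.le b
    linarith

lemma midpoint_eq (a b : Pt) : midpoint ℝ a b = (1/2 : ℝ) • a + (1/2 : ℝ) • b := by
  rw [midpoint_eq_smul_add, smul_add]; norm_num

lemma edgeMid (H : Dec v) (hE : extremePoints ℝ (DPoly v) = range v) :
    edgeMidpoints (DPoly v) = range (fun i => midpoint ℝ (v i) (v (i+1))) := by
  apply subset_antisymm
  · rintro _ ⟨a, b, ⟨hab, hex⟩, rfl⟩
    have ha : a ∈ extremePoints ℝ (DPoly v) := by
      exact hex.extremePoints_subset_extremePoints (left_ext hab)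
    have hb : b ∈ extremePoints ℝ (DPoly v) := by
      apply hex.extremePoints_subset_extremePoints
      rw [segment_symm]
      exact left_ext hab.symm
    rw [hE] at ha hb
    obtain ⟨i, rfl⟩ := ha
    obtain ⟨j, rfl⟩ := hb
    have hij : i ≠ j := fun h => hab (by rw [h])
    by_cases h1 : j = i + 1
    · exact ⟨i, by subst h1; rfl⟩
    by_cases h2 : i = j + 1
    · exact ⟨j, by subst h2; exact midpoint_comm ..⟩
    exfalso
    have hIntr : midpoint ℝ (v i) (v j) ∈ interior (DPoly v) := by
      rw [H.interior_poly]
      intro k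
      rw [midpoint_eq, g_comb _ _ _ _ (by norm_num)]
      have a := H.mem_poly i k
      have b := H.mem_poly j k
      change 0 ≤ g v k _ at a
      change 0 ≤ g v k _ at b
      by_cases hk : i = k
      · have : 0 < g v k (v j) := H.conv k j (by rw [← hk]; exact hij.symm) (by rw [← hk]; exact h1)
        linarith
      by_cases hk' : i = k + 1
      · have : 0 < g v k (v j) := H.conv k j (by rintro rfl; exact h2 hk') (by rw [← hk']; exact hij.symm)
        linarith
      have : 0 < g v k (v i) := H.conv k i hk hk'
      linarith
    -- every vertex is in the segment
    have hall : ∀ k, v k ∈ segment ℝ (v i) (v j) := by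
      intro k
      set m := midpoint ℝ (v i) (v j) with hm
      have hc : ContinuousAt (fun t : ℝ => m + t • (m - v k)) 0 := by fun_prop
      have : ∀ᶠ t in nhds (0 : ℝ), m + t • (m - v k) ∈ interior (DPoly v) :=
        hc (by simpa using isOpen_interior.mem_nhds hIntr)
      obtain ⟨ε, hε, h⟩ := Metric.eventually_nhds_iff.1 this
      have h1 := interior_subset (h (y := ε/2) (by simp [abs_of_pos hε, hε]))
      refine hex.left_mem_of_mem_openSegment (H.mem_poly k) h1 (midpoint_mem_segment _ _) ?_
      refine ⟨(ε/2) / (1 + ε/2), 1 / (1 + ε/2), by positivity, by positivity, by field_simp; ring, ?_⟩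
      ext <;> simp only [Prod.fst_sub, Prod.snd_sub, Prod.fst_add, Prod.snd_add, Prod.smul_fst, Prod.smul_snd, smul_eq_mul] <;> field_simp <;> ring
    obtain ⟨s, t, hs, ht, hst, e⟩ := hall (i+1)
    have hp := H.conv i (i+1+1) (n2 i) (n1 i)
    obtain ⟨s', t', hs', ht', hst', e'⟩ := hall (i+1+1)
    obtain rfl : s = 1 - t := by linarith
    obtain rfl : s' = 1 - t' := by linarith
    have e1 : v (i+1) - v i = t • (v j - v i) := by
      rw [← e, sub_smul, one_smul, smul_sub]; abel
    have e2 : v (i+1+1) - v i = t' • (v j - v i) := by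
      rw [← e', sub_smul, one_smul, smul_sub]; abel
    rw [e1, e2, cr_smul_left, cr_smul_right, cr_self] at hp
    simp at hp
  · rintro _ ⟨i, rfl⟩
    refine ⟨v i, v (i+1), ⟨?_, ?_⟩, rfl⟩
    · intro h
      have := H.ord1 i
      rw [← h, cr_self] at this
      exact lt_irrefl _ this
    · refine ⟨(convex_poly v).segment_subset (H.mem_poly i) (H.mem_poly (i+1)), ?_⟩
      intro x hx y hy z hz hzs
      obtain ⟨a, b, ha, hb, hab, rfl⟩ := hzs
      obtain ⟨s, t, hs, ht, hst, e⟩ := hz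
      have h1 : g v i (a • x + b • y) = 0 := by
        rw [← e, g_comb _ _ _ _ hst, g_self, g_self1]; ring
      rw [g_comb _ _ _ _ hab] at h1
      have hx' := hx i
      have hy' := hy i
      change 0 ≤ g v i _ at hx'
      change 0 ≤ g v i _ at hy'
      have hgx : g v i x = 0 := by
        have := mul_nonneg ha.le hx'
        have := mul_nonneg hb.le hy'
        have : a * g v i x = 0 := by linarith
        exact (mul_eq_zero.1 this).resolve_left ha.ne'
      obtain ⟨r, hr0, hr1, rfl⟩ := H.face hx hgx
      refine ⟨1 - r, r, by linarith, hr0, by ring, ?_⟩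
      rw [smul_sub, sub_smul, one_smul]; abel

end Dec

end Part3

section Part4
open Set Pointwise MeasureTheory

def lin2 (a b : Pt) : Pt →ₗ[ℝ] Pt where
  toFun p := p.1 • a + p.2 • b
  map_add' p q := by simp only [Prod.fst_add, Prod.snd_add, add_smul]; abel
  map_smul' c p := by
    simp only [Prod.smul_fst, Prod.smul_snd, smul_eq_mul, mul_smul, RingHom.id_apply, smul_add]

lemma lin2_apply (a b p : Pt) : lin2 a b p = p.1 • a + p.2 • b := rfl

lemma lin2_det (a b : Pt) : LinearMap.det (lin2 a b) = cr a b := by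
  rw [← LinearMap.det_toMatrix (Module.Basis.finTwoProd ℝ), Matrix.det_fin_two]
  simp [LinearMap.toMatrix_apply, lin2_apply, cr]
  ring

def stdTri : Set Pt := {p | 0 < p.1 ∧ 0 ≤ p.2 ∧ p.1 + p.2 ≤ 1}

lemma meas3 (f g h k : Pt → ℝ) (hf : Continuous f) (hg : Continuous g) (hh : Continuous h)
    (hk : Continuous k) : MeasurableSet {p : Pt | 0 < f p ∧ 0 ≤ g p ∧ h p ≤ k p} := by
  have e : {p : Pt | 0 < f p ∧ 0 ≤ g p ∧ h p ≤ k p} =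
      {p : Pt | 0 < f p} ∩ ({p : Pt | 0 ≤ g p} ∩ {p : Pt | h p ≤ k p}) := rfl
  rw [e]
  exact (isOpen_lt continuous_const hf).measurableSet.inter
    ((isClosed_le continuous_const hg).measurableSet.inter (isClosed_le hh hk).measurableSet)

lemma stdTri_meas : MeasurableSet stdTri :=
  meas3 (fun p => p.1) (fun p => p.2) (fun p => p.1 + p.2) (fun _ => 1)
    (by fun_prop) (by fun_prop) (by fun_prop) (by fun_prop)

lemma stdTri_vol : volume stdTri = ENNReal.ofReal (1/2) := by
  rw [Measure.volume_eq_prod, Measure.prod_apply stdTri_meas]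
  have : ∀ x : ℝ, volume (Prod.mk x ⁻¹' stdTri) = (Ioc (0:ℝ) 1).indicator (fun x => ENNReal.ofReal (1 - x)) x := by
    intro x
    by_cases hx : x ∈ Ioc (0:ℝ) 1
    · rw [indicator_of_mem hx]
      have : Prod.mk x ⁻¹' stdTri = Icc 0 (1 - x) := by
        ext y
        simp only [stdTri, mem_preimage, mem_ofPred_eq, mem_Icc]
        constructor
        · rintro ⟨_, h1, h2⟩; exact ⟨h1, by linarith⟩
        · rintro ⟨h1, h2⟩; exact ⟨hx.1, h1, by linarith⟩
      rw [this, Real.volume_Icc, sub_zero]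
    · rw [indicator_of_notMem hx]
      have : Prod.mk x ⁻¹' stdTri = ∅ := by
        ext y
        simp only [stdTri, mem_preimage, mem_ofPred_eq, mem_empty_iff_false, iff_false]
        rintro ⟨h0, h1, h2⟩; exact hx ⟨h0, by linarith⟩
      rw [this, measure_empty]
  simp_rw [this]
  rw [lintegral_indicator measurableSet_Ioc, ← ofReal_integral_eq_lintegral_ofReal]
  · congr 1
    rw [← intervalIntegral.integral_of_le (by norm_num)]
    rw [intervalIntegral.integral_sub (by simp) (by simp), integral_id]
    simp; norm_num
  · exact (Continuous.integrableOn_Icc (by fun_prop)).mono_set Ioc_subset_Icc_self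
  · filter_upwards [ae_restrict_mem measurableSet_Ioc] with x hx
    simp only [Pi.zero_apply]; linarith [hx.2]

namespace Dec
variable {v : ZMod 10 → Pt}

def tri (v : ZMod 10 → Pt) (i : ZMod 10) : Set Pt :=
  {x | 0 < cr x (v (i+1)) ∧ 0 ≤ cr (v i) x ∧ 0 ≤ g v i x}

lemma tri_meas (v : ZMod 10 → Pt) (i : ZMod 10) : MeasurableSet (tri v i) := by
  refine meas3 (fun x => cr x (v (i+1))) (fun x => cr (v i) x) (fun _ => 0) (fun x => g v i x)
    ?_ ?_ ?_ (g_cont v i)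
  · unfold cr; fun_prop
  · unfold cr; fun_prop
  · fun_prop

lemma tri_eq (H : Dec v) (i : ZMod 10) : tri v i = lin2 (v i) (v (i+1)) '' stdTri := by
  have hp := H.ord1 i
  ext x
  constructor
  · rintro ⟨h1, h2, h3⟩
    refine ⟨(cr x (v (i+1)) / cr (v i) (v (i+1)), cr (v i) x / cr (v i) (v (i+1))), ⟨?_, ?_, ?_⟩, ?_⟩
    · exact div_pos h1 hp
    · exact div_nonneg h2 hp.le
    · simp only
      rw [← add_div, div_le_one hp]
      rw [g, hd] at h3
      rw [cr_swap x]; linarith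
    · exact (H.coord i x).symm
  · rintro ⟨⟨α, β⟩, ⟨h1, h2, h3⟩, rfl⟩
    simp only at h1 h2 h3
    refine ⟨?_, ?_, ?_⟩
    · rw [lin2_apply, cr_add_left, cr_smul_left, cr_smul_left, cr_self]
      simp only [mul_zero, add_zero]; positivity
    · rw [lin2_apply, cr_add_right, cr_smul_right, cr_smul_right, cr_self]
      simp only [mul_zero, zero_add]; positivity
    · rw [g, hd, lin2_apply, cr_add_right, cr_smul_right, cr_smul_right, cr_self, cr_add_right, cr_smul_right,
        cr_smul_right, cr_self, cr_swap (v (i+1))]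
      simp only
      nlinarith

lemma tri_vol (H : Dec v) (i : ZMod 10) :
    volume (tri v i) = ENNReal.ofReal (cr (v i) (v (i+1)) / 2) := by
  rw [H.tri_eq, Measure.addHaar_image_linearMap, lin2_det, stdTri_vol, abs_of_pos (H.ord1 i),
    ← ENNReal.ofReal_mul (H.ord1 i).le]
  congr 1; ring

lemma tri_disj_aux (H : Dec v) (i k : ZMod 10) (hk : k = 1 ∨ k = 2 ∨ k = 3 ∨ k = 4 ∨ k = 5) :
    Disjoint (tri v i) (tri v (i + k)) := by
  rw [Set.disjoint_left]
  rintro x ⟨h1, h2, h3⟩ ⟨h1', h2', h3'⟩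
  have hp := H.ord1 i
  have hx := H.coord i x
  set α := cr x (v (i+1)) / cr (v i) (v (i+1)) with hα'
  set β := cr (v i) x / cr (v i) (v (i+1)) with hβ'
  have hα : 0 < α := div_pos h1 hp
  have hβ : 0 ≤ β := div_nonneg h2 hp.le
  have e : cr (v (i+k)) x = -(α * cr (v i) (v (i+k)) + β * cr (v (i+1)) (v (i+k))) := by
    rw [cr_swap]; nth_rewrite 1 [hx]
    rw [cr_add_left, cr_smul_left, cr_smul_left]
  rw [e] at h2'
  have key : 0 < cr (v i) (v (i+k)) → 0 ≤ cr (v (i+1)) (v (i+k)) → False := by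
    intro a b
    have := mul_pos hα a
    have := mul_nonneg hβ b
    linarith
  rcases hk with rfl | rfl | rfl | rfl | rfl
  · exact key (H.ord1 i) (by rw [cr_self])
  · have := H.ord1 (i+1)
    rw [show i + 1 + 1 = i + 2 by ring] at this
    exact key (H.ord2 i) this.le
  · have := H.ord2 (i+1)
    rw [show i + 1 + 2 = i + 3 by ring] at this
    exact key (H.ord3 i) this.le
  · have := H.ord3 (i+1)
    rw [show i + 1 + 3 = i + 4 by ring] at this
    exact key (H.ord4 i) this.le
  · rw [show i + 5 + 1 = i + 1 + 5 by ring, H.opp, cr_neg_right] at h1'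
    linarith

lemma tri_disj (H : Dec v) : Pairwise (Function.onFun Disjoint (tri v)) := by
  intro i j hij
  obtain ⟨k, rfl⟩ : ∃ k, j = i + k := ⟨j - i, by ring⟩
  have h10 : (10 : ZMod 10) = 0 := rfl
  simp only [Function.onFun]
  rcases zmod10_cases k with h|h|h|h|h|h|h|h|h|h <;> subst h
  · simp at hij
  · exact H.tri_disj_aux i 1 (by tauto)
  · exact H.tri_disj_aux i 2 (by tauto)
  · exact H.tri_disj_aux i 3 (by tauto)
  · exact H.tri_disj_aux i 4 (by tauto)
  · exact H.tri_disj_aux i 5 (by tauto)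
  · have := H.tri_disj_aux (i+6) 4 (by tauto)
    rw [show i + 6 + 4 = i by linear_combination h10] at this; exact this.symm
  · have := H.tri_disj_aux (i+7) 3 (by tauto)
    rw [show i + 7 + 3 = i by linear_combination h10] at this; exact this.symm
  · have := H.tri_disj_aux (i+8) 2 (by tauto)
    rw [show i + 8 + 2 = i by linear_combination h10] at this; exact this.symm
  · have := H.tri_disj_aux (i+9) 1 (by tauto)
    rw [show i + 9 + 1 = i by linear_combination h10] at this; exact this.symm

lemma zero_mem (H : Dec v) : (0 : Pt) ∈ DPoly v := by
  intro i; rw [hd]; have := H.ord1 i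
  simp [cr] at this ⊢; linarith

lemma tri_union (H : Dec v) : DPoly v = insert 0 (⋃ i, tri v i) := by
  apply subset_antisymm
  · intro x hx
    obtain ⟨i, h1, h2⟩ := H.cone x
    rcases h2.lt_or_eq with h2 | h2
    · right; exact mem_iUnion.2 ⟨i, h2, h1, hx i⟩
    · rcases h1.lt_or_eq with h1 | h1
      · right
        refine mem_iUnion.2 ⟨i+1, ?_, ?_, hx (i+1)⟩
        · -- x = β v(i+1)
          have hxx := H.coord i x
          rw [← h2, zero_div, zero_smul, zero_add] at hxx
          rw [hxx, cr_smul_left]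
          exact mul_pos (div_pos h1 (H.ord1 i)) (H.ord1 (i+1))
        · rw [cr_swap, ← h2, neg_zero]
      · left
        have hxx := H.coord i x
        rw [← h2, ← h1] at hxx
        simpa using hxx
  · rintro x (rfl | hx)
    · exact H.zero_mem
    · obtain ⟨i, hi⟩ := mem_iUnion.1 hx
      rw [H.tri_eq] at hi
      obtain ⟨⟨α, β⟩, ⟨h1, h2, h3⟩, rfl⟩ := hi
      simp only at h1 h2 h3
      have hv := (convex_poly v).sum_mem (t := Finset.univ) (w := ![α, β, 1 - α - β])
        (z := ![v i, v (i+1), 0]) (by intro j _; fin_cases j <;> simp <;> linarith)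
        (by simp [Fin.sum_univ_three])
        (by intro j _; fin_cases j <;> simp [H.mem_poly, H.zero_mem])
      simpa [Fin.sum_univ_three, lin2_apply] using hv

/-- area -/
def area (v : ZMod 10 → Pt) : ℝ := cr (v 0) (v 1) + cr (v 1) (v 2) + cr (v 2) (v 3) + cr (v 3) (v 4) + cr (v 4) (v 5)

lemma sum_fin10 (f : Fin 10 → ℝ) : ∑ i, f i = f 0 + f 1 + f 2 + f 3 + f 4 + f 5 + f 6 + f 7 + f 8 + f 9 := by
  simp only [Fin.sum_univ_succ]
  simp only [Finset.univ_eq_empty, Finset.sum_empty]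
  simp only [← add_assoc, add_zero]
  rfl

lemma sum_opp (f : ZMod 10 → ℝ) (h : ∀ i, f (i+5) = f i) : ∑ i, f i = 2 * (f 0 + f 1 + f 2 + f 3 + f 4) := by
  have : ∑ i : ZMod 10, f i = f 0 + f 1 + f 2 + f 3 + f 4 + f (0+5) + f (1+5) + f (2+5) + f (3+5) + f (4+5) := by
    exact sum_fin10 f
  rw [this]; simp only [h]; ring

lemma volume_poly (H : Dec v) : volume (DPoly v) = ENNReal.ofReal (area v) := by
  have h1 : volume (DPoly v) = volume (⋃ i, tri v i) := by
    rw [H.tri_union]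
    apply measure_congr
    exact insert_ae_eq_self _ _
  rw [h1, measure_iUnion H.tri_disj (tri_meas v), tsum_fintype]
  simp_rw [H.tri_vol]
  rw [← ENNReal.ofReal_sum_of_nonneg (fun i _ => by have := H.ord1 i; positivity)]
  congr 1
  rw [sum_opp]
  · simp only [area]
    have e : ∀ j : ZMod 10, (0 + 1 = (1: ZMod 10)) := by decide
    rw [show (0:ZMod 10) + 1 = 1 from rfl, show (1:ZMod 10) + 1 = 2 from rfl, show (2:ZMod 10) + 1 = 3 from rfl,
      show (3:ZMod 10) + 1 = 4 from rfl, show (4:ZMod 10) + 1 = 5 from rfl]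
    ring
  · intro i
    rw [show i + 5 + 1 = i + 1 + 5 by ring, H.opp, H.opp, cr_neg_left, cr_neg_right, neg_neg]

end Dec

end Part4

section Part5
open Set Pointwise MeasureTheory

/-- number of lattice translates of `A` containing `x` -/
def cnt (A : Set Pt) (x : Pt) : ℕ∞ := {l ∈ IntLattice | x - l ∈ A}.encard

def zc (n : ℤ × ℤ) : Pt := ((n.1 : ℝ), (n.2 : ℝ))

def cell (n : ℤ × ℤ) : Set Pt := {x | ⌊x.1⌋ = n.1 ∧ ⌊x.2⌋ = n.2}

lemma zc_inj : Function.Injective zc := by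
  rintro ⟨a, b⟩ ⟨c, d⟩ h
  simp [zc] at h
  exact Prod.ext h.1 h.2

lemma intLattice_eq : IntLattice = range zc := by
  ext x; constructor
  · rintro ⟨a, b, rfl⟩; exact ⟨(a, b), rfl⟩
  · rintro ⟨⟨a, b⟩, rfl⟩; exact ⟨a, b, rfl⟩

lemma cnt_eq (A : Set Pt) (x : Pt) : cnt A x = {n : ℤ × ℤ | x + zc n ∈ A}.encard := by
  have : {l ∈ IntLattice | x - l ∈ A} = (fun n => - zc n) '' {n : ℤ × ℤ | x + zc n ∈ A} := by
    ext l; constructor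
    · rintro ⟨⟨a, b, rfl⟩, h⟩
      refine ⟨(-a, -b), ?_, ?_⟩
      · have : x + zc (-a, -b) = x - ((a:ℝ), (b:ℝ)) := by
          simp only [zc]; ext <;> simp <;> ring
        change x + zc (-a, -b) ∈ A
        rw [this]; exact h
      · simp [zc]
    · rintro ⟨⟨a, b⟩, h, rfl⟩
      refine ⟨⟨-a, -b, by simp [zc]⟩, ?_⟩
      change x - - zc (a, b) ∈ A
      rw [sub_neg_eq_add]; exact h
  rw [cnt, this]
  apply Function.Injective.encard_image
  intro a b h
  exact zc_inj (neg_injective h)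

lemma cell_meas (n : ℤ × ℤ) : MeasurableSet (cell n) := by
  have h1 : Measurable fun x : Pt => ⌊x.1⌋ := Int.measurable_floor.comp measurable_fst
  have h2 : Measurable fun x : Pt => ⌊x.2⌋ := Int.measurable_floor.comp measurable_snd
  have : cell n = (fun x : Pt => ⌊x.1⌋) ⁻¹' {n.1} ∩ (fun x : Pt => ⌊x.2⌋) ⁻¹' {n.2} := rfl
  rw [this]
  exact (h1 (measurableSet_singleton _)).inter (h2 (measurableSet_singleton _))

lemma cell_vol : volume (cell 0) = 1 := by
  have : cell 0 = Ico (0:ℝ) 1 ×ˢ Ico (0:ℝ) 1 := by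
    ext x
    simp only [cell, mem_ofPred_eq, mem_prod, mem_Ico, Prod.fst_zero, Prod.snd_zero, Int.floor_eq_zero_iff]
  rw [this, Measure.volume_eq_prod, Measure.prod_prod]
  simp

lemma cell_disj : Pairwise (Function.onFun Disjoint cell) := by
  intro i j h
  rw [Function.onFun, Set.disjoint_left]
  rintro x ⟨h1, h2⟩ ⟨h3, h4⟩
  exact h (Prod.ext (h1.symm.trans h3) (h2.symm.trans h4))

lemma cell_union : ⋃ n, cell n = univ := by
  ext x; simp only [mem_iUnion, mem_univ, iff_true]
  exact ⟨(⌊x.1⌋, ⌊x.2⌋), rfl, rfl⟩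

lemma cnt_tsum (A : Set Pt) (x : Pt) :
    ((cnt A x : ℕ∞) : ENNReal) = ∑' n : ℤ × ℤ, A.indicator (fun _ => (1 : ENNReal)) (x + zc n) := by
  rw [cnt_eq, ← ENNReal.tsum_set_one, tsum_subtype {n : ℤ × ℤ | x + zc n ∈ A} (fun _ => (1 : ENNReal))]
  rfl

lemma lint_cnt (A : Set Pt) (hA : MeasurableSet A) :
    ∫⁻ x in cell 0, ((cnt A x : ℕ∞) : ENNReal) = volume A := by
  simp_rw [cnt_tsum]
  rw [lintegral_tsum]
  · have h1 : ∀ n : ℤ × ℤ, ∫⁻ x in cell 0, A.indicator (fun _ => (1 : ENNReal)) (x + zc n) =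
        volume (A ∩ cell n) := by
      intro n
      have hm : Measurable fun x : Pt => x + zc n := measurable_add_const _
      have : (fun x => A.indicator (fun _ => (1 : ENNReal)) (x + zc n)) =
        ((fun x => x + zc n) ⁻¹' A).indicator 1 := rfl
      rw [this, lintegral_indicator_one (hm hA), Measure.restrict_apply (hm hA),
        ← measure_preimage_add_right volume (zc n) (A ∩ cell n)]
      congr 1
      ext x
      simp only [mem_inter_iff, mem_preimage, cell, mem_ofPred_eq, zc, Prod.fst_add, Prod.snd_add,
        Int.floor_add_intCast, Prod.fst_zero, Prod.snd_zero, add_eq_right]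
    simp_rw [h1]
    rw [← measure_iUnion]
    · rw [← inter_iUnion, cell_union, inter_univ]
    · intro i j h
      exact (cell_disj h).mono inter_subset_right inter_subset_right
    · exact fun n => hA.inter (cell_meas n)
  · intro n
    have hm : Measurable fun x : Pt => x + zc n := measurable_add_const _
    exact ((measurable_const.indicator hA).comp hm).aemeasurable

/-- area of a tiling -/
lemma tiling_vol {K : Set Pt} {k : ℕ} (hK : MeasurableSet K) (hc : Convex ℝ K)
    (h1 : ∀ p, (k : ℕ∞) ≤ cnt K p) (h2 : ∀ p, cnt (interior K) p ≤ k) : volume K = k := by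
  apply le_antisymm
  · have : volume K = volume (interior K) := by
      apply le_antisymm _ (measure_mono interior_subset)
      calc volume K ≤ volume (interior K ∪ frontier K) := measure_mono (by
              rw [← closure_eq_interior_union_frontier]
              exact subset_closure)
        _ ≤ volume (interior K) + volume (frontier K) := measure_union_le _ _
        _ = volume (interior K) := by rw [hc.addHaar_frontier volume, add_zero]
    rw [this, ← lint_cnt _ isOpen_interior.measurableSet]
    calc _ ≤ ∫⁻ x in cell 0, (k : ENNReal) := by
          apply lintegral_mono
          intro x
          have := h2 x
          show _ ≤ _
          simpa using (ENat.toENNReal_le.2 this)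
      _ = k := by simp [cell_vol]
  · rw [← lint_cnt _ hK]
    calc (k : ENNReal) = ∫⁻ x in cell 0, (k : ENNReal) := by simp [cell_vol]
      _ ≤ _ := by
          apply lintegral_mono
          intro x
          have := h1 x
          show _ ≤ _
          simpa using (ENat.toENNReal_le.2 this)

lemma Dec.tiling_area {v : ZMod 10 → Pt} (H : Dec v) {k : ℕ}
    (h1 : ∀ p, (k : ℕ∞) ≤ cnt (DPoly v) p) (h2 : ∀ p, cnt (interior (DPoly v)) p ≤ k) :
    area v = k := by
  have := tiling_vol (closed_poly v).measurableSet (convex_poly v) h1 h2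
  rw [H.volume_poly, ← ENNReal.ofReal_natCast] at this
  refine (ENNReal.ofReal_eq_ofReal_iff ?_ (by positivity)).1 this
  have a0 := H.ord1 0; have a1 := H.ord1 1; have a2 := H.ord1 2; have a3 := H.ord1 3; have a4 := H.ord1 4
  unfold area
  have : cr (v 0) (v 1) = cr (v 0) (v (0+1)) := rfl
  have : cr (v 1) (v 2) = cr (v 1) (v (1+1)) := rfl
  have : cr (v 2) (v 3) = cr (v 2) (v (2+1)) := rfl
  have : cr (v 3) (v 4) = cr (v 3) (v (3+1)) := rfl
  have : cr (v 4) (v 5) = cr (v 4) (v (4+1)) := rfl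
  linarith

end Part5

section Part6
open Set Pointwise MeasureTheory Topology

lemma lat_closed : IsClosed IntLattice := by
  have h := Int.isClosedEmbedding_coe_real.isClosed_range
  have : IntLattice = Prod.fst ⁻¹' (range ((↑) : ℤ → ℝ)) ∩ Prod.snd ⁻¹' (range ((↑) : ℤ → ℝ)) := by
    ext x; constructor
    · rintro ⟨a, b, rfl⟩; exact ⟨⟨a, rfl⟩, ⟨b, rfl⟩⟩
    · rintro ⟨⟨a, ha⟩, ⟨b, hb⟩⟩; exact ⟨a, b, Prod.ext ha.symm hb.symm⟩
  rw [this]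
  exact (h.preimage continuous_fst).inter (h.preimage continuous_snd)

lemma lat_zero : (0 : Pt) ∈ IntLattice := ⟨0, 0, by ext <;> simp⟩
lemma lat_add {x y : Pt} (hx : x ∈ IntLattice) (hy : y ∈ IntLattice) : x + y ∈ IntLattice := by
  obtain ⟨a, b, rfl⟩ := hx; obtain ⟨c, d, rfl⟩ := hy
  exact ⟨a + c, b + d, by simp⟩
lemma lat_neg {x : Pt} (hx : x ∈ IntLattice) : -x ∈ IntLattice := by
  obtain ⟨a, b, rfl⟩ := hx
  exact ⟨-a, -b, by simp⟩
lemma lat_sub {x y : Pt} (hx : x ∈ IntLattice) (hy : y ∈ IntLattice) : x - y ∈ IntLattice := by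
  rw [sub_eq_add_neg]; exact lat_add hx (lat_neg hy)
lemma lat_neg_iff {x : Pt} : -x ∈ IntLattice ↔ x ∈ IntLattice :=
  ⟨fun h => by simpa using lat_neg h, lat_neg⟩
lemma lat_cr {x y : Pt} (hx : x ∈ IntLattice) (hy : y ∈ IntLattice) : ∃ n : ℤ, cr x y = n := by
  obtain ⟨a, b, rfl⟩ := hx; obtain ⟨c, d, rfl⟩ := hy
  exact ⟨a * d - b * c, by simp [cr]⟩
lemma lat_countable : IntLattice.Countable := by
  rw [intLattice_eq]; exact countable_range _

lemma lat_fin {B : Set Pt} (hB : Bornology.IsBounded B) : (IntLattice ∩ B).Finite := by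
  obtain ⟨R, hR⟩ := hB.subset_closedBall 0
  apply ((finite_Icc (-⌈R⌉, -⌈R⌉) ((⌈R⌉, ⌈R⌉) : ℤ × ℤ)).image zc).subset
  rintro x ⟨⟨a, b, rfl⟩, hx⟩
  have := hR hx
  rw [mem_closedBall_zero_iff, Prod.norm_def] at this
  simp only [Real.norm_eq_abs, sup_le_iff, abs_le] at this
  obtain ⟨⟨h1, h2⟩, h3, h4⟩ := this
  have hc := Int.le_ceil R
  refine ⟨(a, b), ⟨⟨?_, ?_⟩, ?_, ?_⟩, rfl⟩
  · have : ((-⌈R⌉ : ℤ) : ℝ) ≤ a := by push_cast; linarith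
    exact_mod_cast this
  · have : ((-⌈R⌉ : ℤ) : ℝ) ≤ b := by push_cast; linarith
    exact_mod_cast this
  · have : (a : ℝ) ≤ ⌈R⌉ := by linarith
    exact_mod_cast this
  · have : (b : ℝ) ≤ ⌈R⌉ := by linarith
    exact_mod_cast this

lemma bd_aux {K : Set Pt} (hK : Bornology.IsBounded K) (C : Set Pt) (hC : Bornology.IsBounded C) :
    {l ∈ IntLattice | ∃ y ∈ C, y - l ∈ K}.Finite := by
  apply (lat_fin (hC.sub hK)).subset
  rintro l ⟨hl, y, hy, h⟩
  exact ⟨hl, y, hy, y - l, h, by simp⟩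

lemma inc_fin {K : Set Pt} (hK : Bornology.IsBounded K) (x : Pt) :
    {l ∈ IntLattice | x - l ∈ K}.Finite := by
  apply (bd_aux hK {x} Bornology.isBounded_singleton).subset
  rintro l ⟨hl, h⟩
  exact ⟨hl, x, rfl, h⟩

lemma near {K : Set Pt} (hK : Bornology.IsBounded K) (hc : IsClosed K) (x : Pt) :
    ∀ᶠ y in 𝓝 x, ∀ l ∈ IntLattice, y - l ∈ K → x - l ∈ K := by
  have h1 := Metric.closedBall_mem_nhds x (zero_lt_one (α := ℝ))
  have hf := bd_aux hK (Metric.closedBall x 1) Metric.isBounded_closedBall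
  have h2 : ∀ᶠ y in 𝓝 x, ∀ l ∈ {l ∈ IntLattice | ∃ y ∈ Metric.closedBall x 1, y - l ∈ K},
      y - l ∈ K → x - l ∈ K := by
    rw [Filter.eventually_all_finite hf]
    intro l _
    by_cases h : x - l ∈ K
    · exact Filter.Eventually.of_forall fun _ _ => h
    · have : (fun y => y - l) ⁻¹' Kᶜ ∈ 𝓝 x :=
        (continuous_id.sub continuous_const).continuousAt.preimage_mem_nhds (hc.isOpen_compl.mem_nhds h)
      filter_upwards [this] with y hy hy'
      exact absurd hy' hy
  filter_upwards [h1, h2] with y hy1 hy2 l hl hyl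
  exact hy2 l ⟨hl, y, hy1, hyl⟩ hyl

namespace Dec
variable {v : ZMod 10 → Pt}

lemma bounded_poly (H : Dec v) : Bornology.IsBounded (DPoly v) := by
  rw [H.poly_eq]
  exact (isBounded_convexHull).2 (finite_range v).isBounded

/-- edge vector -/
def ed (v : ZMod 10 → Pt) (i : ZMod 10) : Pt := v (i + 1) - v i

lemma ed_opp (H : Dec v) (i : ZMod 10) : ed v (i+5) = - ed v i := by
  rw [ed, show i + 5 + 1 = i + 1 + 5 by ring, H.opp, H.opp, ed]; abel

lemma g_shift (v : ZMod 10 → Pt) (i : ZMod 10) (x y : Pt) : g v i (x + y) = g v i x + cr (ed v i) y := by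
  rw [g_add]; rfl

lemma g_neg (H : Dec v) (i : ZMod 10) (x : Pt) : g v i x + g v i (-x) = g v i (v (i+5)) := by
  rw [H.opp]
  simp [g, cr]; ring

lemma cr1 (H : Dec v) (i : ZMod 10) : 0 < cr (ed v i) (ed v (i+1)) := H.turn i

lemma cr2 (H : Dec v) (i : ZMod 10) : 0 < cr (ed v i) (ed v (i+2)) := by
  have m1 : i + 5 ≠ i + 1 := by revert i; decide
  have m2 : i + 5 ≠ i + 1 + 1 := by revert i; decide
  have m3 : i + 5 ≠ i + 2 := by revert i; decide
  have m4 : i + 5 ≠ i + 2 + 1 := by revert i; decide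
  have m5 : i + 2 + 5 ≠ i := by revert i; decide
  have m6 : i + 2 + 5 ≠ i + 1 := by revert i; decide
  set z := v (i+5) - v (i+2) with hz
  have h1 : 0 < cr (ed v (i+1)) z := by
    have := H.conv (i+1) (i+5) m1 m2
    rw [hz, ed]
    have e : i + 1 + 1 = i + 2 := by ring
    rw [e] at this ⊢
    have : cr (v (i+2) - v (i+1)) (v (i+5) - v (i+2)) = cr (v (i+2) - v (i+1)) (v (i+5) - v (i+1)) := by
      simp [cr]; ring
    linarith
  have h2 : 0 < cr (ed v (i+2)) z := H.conv (i+2) (i+5) m3 m4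
  have h3 : 0 < cr (ed v i) z := by
    have h := H.conv i (i+2+5) m5 m6
    have h' := H.g_neg i (v (i+2))
    rw [← H.opp] at h'
    have : cr (ed v i) z = g v i (v (i+5)) - g v i (v (i+2)) := by
      rw [hz]; simp only [g, ed, cr, Prod.fst_sub, Prod.snd_sub]; ring
    have h'' : 0 < g v i (v (i+2+5)) := h
    linarith
  have h01 := H.cr1 i
  have h12 := H.cr1 (i+1)
  rw [show i + 1 + 1 = i + 2 by ring] at h12
  have key : cr (ed v i) (ed v (i+2)) * cr (ed v (i+1)) z =
      cr (ed v i) (ed v (i+1)) * cr (ed v (i+2)) z + cr (ed v i) z * cr (ed v (i+1)) (ed v (i+2)) := by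
    simp only [cr]; ring
  have : 0 < cr (ed v i) (ed v (i+2)) * cr (ed v (i+1)) z := by rw [key]; positivity
  exact pos_of_mul_pos_left this h1.le

lemma cr3 (H : Dec v) (i : ZMod 10) : 0 < cr (ed v i) (ed v (i+3)) := by
  have := H.cr2 (i+3)
  rw [show i + 3 + 2 = i + 5 by ring, H.ed_opp, cr_neg_right, ← cr_swap] at this
  exact this

lemma cr4 (H : Dec v) (i : ZMod 10) : 0 < cr (ed v i) (ed v (i+4)) := by
  have := H.cr1 (i+4)
  rw [show i + 4 + 1 = i + 5 by ring, H.ed_opp, cr_neg_right, ← cr_swap] at this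
  exact this

lemma cr_ne (H : Dec v) {i j : ZMod 10} (h0 : j ≠ i) (h5 : j ≠ i + 5) : cr (ed v j) (ed v i) ≠ 0 := by
  obtain ⟨k, rfl⟩ : ∃ k, i = j + k := ⟨i - j, by ring⟩
  have n6 := H.cr1 j; have n7 := H.cr2 j; have n8 := H.cr3 j; have n9 := H.cr4 j
  have h10 : (10 : ZMod 10) = 0 := rfl
  rcases zmod10_cases k with h|h|h|h|h|h|h|h|h|h <;> subst h
  · simp at h0
  · exact n6.ne'
  · exact n7.ne'
  · exact n8.ne'
  · exact n9.ne'
  · exfalso; apply h5; linear_combination -h10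
  · rw [show j + 6 = j + 1 + 5 by ring, H.ed_opp, cr_neg_right]; exact (neg_neg_of_pos n6).ne
  · rw [show j + 7 = j + 2 + 5 by ring, H.ed_opp, cr_neg_right]; exact (neg_neg_of_pos n7).ne
  · rw [show j + 8 = j + 3 + 5 by ring, H.ed_opp, cr_neg_right]; exact (neg_neg_of_pos n8).ne
  · rw [show j + 9 = j + 4 + 5 by ring, H.ed_opp, cr_neg_right]; exact (neg_neg_of_pos n9).ne

lemma g_opp_pos (H : Dec v) (i : ZMod 10) : 0 < g v i (v (i+5)) :=
  H.conv i (i+5) (by revert i; decide) (by revert i; decide)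

lemma g_width (H : Dec v) (i : ZMod 10) (x : Pt) : g v i x + g v (i+5) x = g v i (v (i+5)) := by
  have := H.g_opp i (-x)
  rw [neg_neg] at this
  rw [this, H.g_neg]

def Aset (v : ZMod 10 → Pt) (i : ZMod 10) (x : Pt) : Set Pt :=
  {l ∈ IntLattice | x - l ∈ DPoly v ∧ g v i (x - l) = 0}

def Gen (v : ZMod 10 → Pt) (i : ZMod 10) (x : Pt) : Prop :=
  ∀ l ∈ IntLattice, ∀ j, g v j (x - l) = 0 → j = i ∨ j = i + 5

/-- one-sided count -/
lemma side (H : Dec v) {k : ℕ} (h1 : ∀ p, (k : ℕ∞) ≤ cnt (DPoly v) p)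
    (h2 : ∀ p, cnt (interior (DPoly v)) p ≤ k) (i : ZMod 10) (x : Pt) (hx : Gen v i x) :
    cnt (interior (DPoly v)) x + (Aset v i x).encard = k := by
  -- direction
  obtain ⟨n, hn⟩ : ∃ n : Pt, 0 < cr (ed v i) n := ⟨ed v (i+1), H.cr1 i⟩
  have hlim : Filter.Tendsto (fun δ : ℝ => x + δ • n) (𝓝[>] 0) (𝓝 x) := by
    have : Continuous fun δ : ℝ => x + δ • n := by fun_prop
    have h := this.tendsto 0
    simp only [zero_smul, add_zero] at h
    exact h.mono_left nhdsWithin_le_nhds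
  have e1 := hlim.eventually (near H.bounded_poly (closed_poly v) x)
  have hfin := inc_fin H.bounded_poly x
  have e2 : ∀ᶠ y in 𝓝 x, ∀ l ∈ {l ∈ IntLattice | x - l ∈ DPoly v}, ∀ j : ZMod 10,
      0 < g v j (x - l) → 0 < g v j (y - l) := by
    rw [Filter.eventually_all_finite hfin]
    intro l _
    rw [Filter.eventually_all]
    intro j
    by_cases h : 0 < g v j (x - l)
    · have hc : Continuous fun y => g v j (y - l) := (g_cont v j).comp (by fun_prop)
      filter_upwards [hc.continuousAt.eventually (lt_mem_nhds h)] with y hy _ using hy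
    · exact Filter.Eventually.of_forall fun _ h' => absurd h' h
  have e2 := hlim.eventually e2
  have e3 : ∀ᶠ δ : ℝ in 𝓝[>] 0, 0 < δ := self_mem_nhdsWithin
  obtain ⟨δ, d1, d2, d3⟩ := (e1.and (e2.and e3)).exists
  set y := x + δ • n with hy
  have gy : ∀ j l, g v j (y - l) = g v j (x - l) + δ * cr (ed v j) n := by
    intro j l
    rw [hy, show x + δ • n - l = (x - l) + δ • n by abel, g_shift, cr_smul_right]
  have hpos : 0 < δ * cr (ed v i) n := mul_pos d3 hn
  have hdisj : Disjoint {l ∈ IntLattice | x - l ∈ interior (DPoly v)} (Aset v i x) := by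
    rw [Set.disjoint_left]
    rintro l ⟨_, hl⟩ ⟨_, _, hl'⟩
    rw [H.interior_poly] at hl
    exact absurd hl' (hl i).ne'
  rw [cnt, ← encard_union_eq hdisj]
  apply le_antisymm
  · refine le_trans (encard_le_encard ?_) (h2 y)
    rintro l (⟨hl, hl'⟩ | ⟨hl, hl', hl''⟩)
    · refine ⟨hl, ?_⟩
      have hm : x - l ∈ DPoly v := interior_subset hl'
      rw [H.interior_poly] at hl' ⊢
      intro j
      exact d2 l ⟨hl, hm⟩ j (hl' j)
    · refine ⟨hl, ?_⟩
      rw [H.interior_poly]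
      intro j
      rcases (hl' j).lt_or_eq with h | h
      · exact d2 l ⟨hl, hl'⟩ j h
      · rcases hx l hl j h.symm with rfl | rfl
        · rw [gy, hl'']; linarith
        · have := H.g_width i (x - l)
          have h5 := H.g_opp_pos i
          have h' : 0 = g v (i+5) (x - l) := h
          linarith
  · refine le_trans (h1 y) (encard_le_encard ?_)
    rintro l ⟨hl, hl'⟩
    have hm := d1 l hl hl'
    by_cases hA : g v i (x - l) = 0
    · right; exact ⟨hl, hm, hA⟩
    · left; refine ⟨hl, ?_⟩
      rw [H.interior_poly]
      intro j
      rcases (hm j).lt_or_eq with h | h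
      · exact h
      · exfalso
        rcases hx l hl j h.symm with rfl | rfl
        · exact hA h.symm
        · have h4 : 0 ≤ g v (i+5) (y - l) := hl' (i+5)
          have h' : 0 = g v (i+5) (x - l) := h
          rw [gy, H.ed_opp, cr_neg_left, ← h'] at h4
          linarith

lemma gen_opp {i : ZMod 10} {x : Pt} (hx : Gen v i x) : Gen v (i+5) x := by
  intro l hl j hj
  have h10 : (10 : ZMod 10) = 0 := rfl
  rcases hx l hl j hj with h | h
  · right; rw [h]; linear_combination -h10
  · left; exact h

lemma AB (H : Dec v) {k : ℕ} (h1 : ∀ p, (k : ℕ∞) ≤ cnt (DPoly v) p)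
    (h2 : ∀ p, cnt (interior (DPoly v)) p ≤ k) (i : ZMod 10) (x : Pt) (hx : Gen v i x) :
    (Aset v i x).encard = (Aset v (i+5) x).encard := by
  have a := H.side h1 h2 i x hx
  have b := H.side h1 h2 (i+5) x (gen_opp hx)
  have hf : cnt (interior (DPoly v)) x ≠ ⊤ := ((h2 x).trans_lt (ENat.natCast_lt_top k)).ne
  rw [← b] at a
  exact (ENat.add_left_injective_of_ne_top hf) (by simpa [add_comm] using a)

lemma gen_dense (H : Dec v) (i : ZMod 10) (c d : ℝ) (hcd : c < d) :
    ∃ t, c < t ∧ t < d ∧ Gen v i (v i + t • ed v i) := by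
  have hc : (⋃ l ∈ IntLattice, ⋃ j ∈ {j : ZMod 10 | j ≠ i ∧ j ≠ i + 5},
      {t : ℝ | g v j (v i + t • ed v i - l) = 0}).Countable := by
    refine lat_countable.biUnion fun l _ => (to_countable _).biUnion fun j hj => ?_
    apply Set.Subsingleton.countable
    intro s hs t ht
    have e : ∀ r : ℝ, g v j (v i + r • ed v i - l) = g v j (v i - l) + r * cr (ed v j) (ed v i) := by
      intro r
      rw [show v i + r • ed v i - l = (v i - l) + r • ed v i by abel, g_shift, cr_smul_right]
    have hs' : g v j (v i + s • ed v i - l) = 0 := hs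
    have ht' : g v j (v i + t • ed v i - l) = 0 := ht
    rw [e] at hs' ht'
    have hne := H.cr_ne hj.1 hj.2
    have : (s - t) * cr (ed v j) (ed v i) = 0 := by linarith
    rcases mul_eq_zero.1 this with h | h
    · linarith
    · exact absurd h hne
  obtain ⟨t, ht, h1, h2⟩ := (hc.dense_compl ℝ).exists_between hcd
  refine ⟨t, h1, h2, ?_⟩
  intro l hl j hj
  by_contra hcon
  push Not at hcon
  apply ht
  exact mem_biUnion hl (mem_biUnion (show j ∈ {j : ZMod 10 | j ≠ i ∧ j ≠ i + 5} from hcon) hj)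

lemma mem_edge (H : Dec v) (i : ZMod 10) (t : ℝ) (h0 : 0 ≤ t) (h1 : t ≤ 1) :
    v i + t • ed v i ∈ DPoly v ∧ g v i (v i + t • ed v i) = 0 := by
  constructor
  · have := convex_poly v (H.mem_poly i) (H.mem_poly (i+1)) (show 0 ≤ 1 - t by linarith) h0 (by ring)
    rw [ed, smul_sub]
    convert this using 1
    rw [sub_smul, one_smul]; abel
  · rw [g_shift, g_self, cr_smul_right, cr_self]; ring

lemma Aset_iff (H : Dec v) (i : ZMod 10) (t : ℝ) (l : Pt) :
    l ∈ Aset v i (v i + t • ed v i) ↔ l ∈ IntLattice ∧ ∃ s, t - 1 ≤ s ∧ s ≤ t ∧ l = s • ed v i := by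
  constructor
  · rintro ⟨hl, h1, h2⟩
    obtain ⟨r, r0, r1, hr⟩ := H.face h1 h2
    refine ⟨hl, t - r, by linarith, by linarith, ?_⟩
    have hr' : v i + t • ed v i - l = v i + r • ed v i := hr
    rw [sub_smul]
    have : l = (v i + t • ed v i) - (v i + r • ed v i) := by rw [← hr']; abel
    rw [this]; abel
  · rintro ⟨hl, s, h1, h2, h3⟩
    have := H.mem_edge i (t - s) (by linarith) (by linarith)
    have e : v i + t • ed v i - l = v i + (t - s) • ed v i := by rw [h3, sub_smul]; abel
    exact ⟨hl, by rw [e]; exact this⟩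

lemma Aset_iff' (H : Dec v) (i : ZMod 10) (t : ℝ) (l : Pt) :
    l ∈ Aset v (i+5) (v i + t • ed v i) ↔
      l ∈ IntLattice ∧ ∃ s, t ≤ s ∧ s ≤ t + 1 ∧ l = v i + v i + s • ed v i := by
  constructor
  · rintro ⟨hl, h1, h2⟩
    obtain ⟨r, r0, r1, hr⟩ := H.face h1 h2
    refine ⟨hl, t + r, by linarith, by linarith, ?_⟩
    have hr' : v i + t • ed v i - l = v (i+5) + r • ed v (i+5) := hr
    rw [H.opp, H.ed_opp, smul_neg] at hr'
    rw [add_smul]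
    have : l = (v i + t • ed v i) - (- v i + - (r • ed v i)) := by rw [← hr']; abel
    rw [this]; abel
  · rintro ⟨hl, s, h1, h2, h3⟩
    have := H.mem_edge (i+5) (s - t) (by linarith) (by linarith)
    have e : v i + t • ed v i - l = v (i+5) + (s - t) • ed v (i+5) := by
      rw [h3, H.opp, H.ed_opp, smul_neg, sub_smul]; abel
    exact ⟨hl, by rw [e]; exact this⟩

/-- Bolle necessary condition -/
lemma bolle (H : Dec v) {k : ℕ} (h1 : ∀ p, (k : ℕ∞) ≤ cnt (DPoly v) p)
    (h2 : ∀ p, cnt (interior (DPoly v)) p ≤ k) (i : ZMod 10) :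
    v i + v (i+1) ∈ IntLattice ∨
      (ed v i ∈ IntLattice ∧ ∃ n : ℤ, cr (ed v i) (v i + v (i+1)) = n) := by
  by_cases he : ed v i ∈ IntLattice
  · right; refine ⟨he, ?_⟩
    obtain ⟨t, t0, t1, hg⟩ := H.gen_dense i 0 1 zero_lt_one
    have := H.AB h1 h2 i _ hg
    have hne : (Aset v i (v i + t • ed v i)).Nonempty :=
      ⟨0, (H.Aset_iff i t 0).2 ⟨lat_zero, 0, by linarith, by linarith, by simp⟩⟩
    rw [← encard_ne_zero, this, encard_ne_zero] at hne
    obtain ⟨l, hl⟩ := hne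
    obtain ⟨hl, s, -, -, hs⟩ := (H.Aset_iff' i t l).1 hl
    obtain ⟨n, hn⟩ := lat_cr he hl
    refine ⟨n, ?_⟩
    rw [← hn, hs]
    simp only [cr, ed, Prod.fst_add, Prod.snd_add, Prod.fst_sub, Prod.snd_sub, Prod.smul_fst, Prod.smul_snd,
      smul_eq_mul]
    ring
  · left
    by_contra hw
    have c1 : ∀ᶠ s : ℝ in 𝓝 (-1), s • ed v i ∉ IntLattice := by
      have : Continuous fun s : ℝ => s • ed v i := by fun_prop
      refine this.continuousAt.eventually (lat_closed.isOpen_compl.mem_nhds ?_)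
      simp only [neg_smul, one_smul]
      exact fun h => he (lat_neg_iff.1 h)
    have c2 : ∀ᶠ s : ℝ in 𝓝 1, v i + v i + s • ed v i ∉ IntLattice := by
      have : Continuous fun s : ℝ => v i + v i + s • ed v i := by fun_prop
      refine this.continuousAt.eventually (lat_closed.isOpen_compl.mem_nhds ?_)
      have e : v i + v i + (1:ℝ) • ed v i = v i + v (i+1) := by rw [one_smul, ed]; abel
      show v i + v i + (1:ℝ) • ed v i ∉ IntLattice
      rw [e]; exact hw
    obtain ⟨ε1, p1, q1⟩ := Metric.eventually_nhds_iff.1 c1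
    obtain ⟨ε2, p2, q2⟩ := Metric.eventually_nhds_iff.1 c2
    simp only [Real.dist_eq] at q1 q2
    set ε := min (min ε1 ε2) (1/2) with hε
    have hεp : 0 < ε := by positivity
    have le1 : ε ≤ ε1 := (min_le_left _ _).trans (min_le_left _ _)
    have le2 : ε ≤ ε2 := (min_le_left _ _).trans (min_le_right _ _)
    have le3 : ε ≤ 1/2 := min_le_right _ _
    obtain ⟨t, t0, t1, ht⟩ := H.gen_dense i 0 ε hεp
    obtain ⟨r, r0, r1, hr⟩ := H.gen_dense i (-ε) 0 (by linarith)
    have ABt := H.AB h1 h2 i _ ht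
    have ABr := H.AB h1 h2 i _ hr
    have fin : ∀ x, (Aset v i x).Finite := fun x =>
      (inc_fin H.bounded_poly x).subset fun l hl => ⟨hl.1, hl.2.1⟩
    have s1 : Aset v i (v i + r • ed v i) ⊂ Aset v i (v i + t • ed v i) := by
      rw [ssubset_iff_exists]
      constructor
      · intro l hl
        obtain ⟨hl, s, a, b, rfl⟩ := (H.Aset_iff i r l).1 hl
        refine (H.Aset_iff i t _).2 ⟨hl, s, ?_, by linarith, rfl⟩
        by_contra hcon
        push Not at hcon
        exact q1 (by rw [abs_lt]; constructor <;> linarith) hl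
      · refine ⟨0, (H.Aset_iff i t 0).2 ⟨lat_zero, 0, by linarith, by linarith, by simp⟩, ?_⟩
        intro h
        obtain ⟨_, s, a, b, hs⟩ := (H.Aset_iff i r 0).1 h
        have hc := H.cr1 i
        have : cr (s • ed v i) (ed v (i+1)) = 0 := by rw [← hs]; simp [cr]
        rw [cr_smul_left] at this
        rcases mul_eq_zero.1 this with h | h <;> linarith
    have s2 : Aset v (i+5) (v i + t • ed v i) ⊆ Aset v (i+5) (v i + r • ed v i) := by
      intro l hl
      obtain ⟨hl, s, a, b, rfl⟩ := (H.Aset_iff' i t l).1 hl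
      refine (H.Aset_iff' i r _).2 ⟨hl, s, by linarith, ?_, rfl⟩
      by_contra hcon
      push Not at hcon
      exact q2 (by rw [abs_lt]; constructor <;> linarith) hl
    have l1 := (fin (v i + r • ed v i)).encard_lt_encard s1
    have l2 := encard_le_encard s2
    rw [← ABt, ← ABr] at l2
    exact absurd l1 (not_lt.2 l2)

end Dec

end Part6

section Part7
open Set Pointwise MeasureTheory Topology

/-- sum of all pairwise cross products -/
def S10 (a b c d e : Pt) : ℝ := cr a b + cr a c + cr a d + cr a e + cr b c + cr b d + cr b e +
  cr c d + cr c e + cr d e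

lemma one_le_of_int {x : ℝ} (h : ∃ n : ℤ, x = n) (hx : 0 < x) : 1 ≤ x := by
  obtain ⟨n, rfl⟩ := h
  exact_mod_cast (by exact_mod_cast hx : (0:ℤ) < n)

lemma lat_cr_one {x y : Pt} (hx : x ∈ IntLattice) (hy : y ∈ IntLattice) (h : 0 < cr x y) : 1 ≤ cr x y :=
  one_le_of_int (lat_cr hx hy) h

lemma adj_aux (e0 e1 e2 e3 e4 : Pt) (p01 : 0 < cr e0 e1) (p02 : 0 < cr e0 e2) (p03 : 0 < cr e0 e3)
    (p04 : 0 < cr e0 e4) (p12 : 0 < cr e1 e2) (p13 : 0 < cr e1 e3) (p14 : 0 < cr e1 e4)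
    (p23 : 0 < cr e2 e3) (p24 : 0 < cr e2 e4) (p34 : 0 < cr e3 e4)
    (m0 : e0 ∈ IntLattice) (m1 : e1 ∈ IntLattice) (m23 : e2 + e3 ∈ IntLattice)
    (m34 : e3 + e4 ∈ IntLattice) (n0 : ∃ n : ℤ, cr e0 (e1 + e2 + e3 + e4) = n)
    (n1 : ∃ n : ℤ, cr e1 (e0 - e2 - e3 - e4) = n) : 8 ≤ S10 e0 e1 e2 e3 e4 := by
  obtain ⟨a, ha⟩ := lat_cr m0 m23
  obtain ⟨b, hb⟩ := lat_cr m0 m34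
  obtain ⟨c, hc⟩ := n0
  obtain ⟨d, hd⟩ := lat_cr m0 m1
  obtain ⟨a', ha'⟩ := lat_cr m1 m23
  obtain ⟨b', hb'⟩ := lat_cr m1 m34
  obtain ⟨c', hc'⟩ := n1
  have hx := lat_cr_one m23 m34 (by
    simp only [cr_add_left, cr_add_right, cr_self]; linarith)
  simp only [cr_add_left, cr_add_right, cr_self, cr_sub_right] at *
  rw [cr_swap e1 e0] at hc'
  have q1 : 1 ≤ cr e0 e4 := one_le_of_int ⟨c - d - a, by push_cast; linarith⟩ p04
  have q2 : 1 ≤ cr e0 e2 := one_le_of_int ⟨c - d - b, by push_cast; linarith⟩ p02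
  have q3 : 1 ≤ cr e0 e3 := one_le_of_int ⟨a + b - c + d, by push_cast; linarith⟩ p03
  have q1' : 1 ≤ cr e1 e4 := one_le_of_int ⟨- c' - d - a', by push_cast; linarith⟩ p14
  have q2' : 1 ≤ cr e1 e2 := one_le_of_int ⟨- c' - d - b', by push_cast; linarith⟩ p12
  have q3' : 1 ≤ cr e1 e3 := one_le_of_int ⟨a' + b' + c' + d, by push_cast; linarith⟩ p13
  have q4 : 1 ≤ cr e0 e1 := one_le_of_int ⟨d, hd⟩ p01
  unfold S10; linarith

lemma dist_aux (e0 e1 e2 e3 e4 : Pt) (p01 : 0 < cr e0 e1) (p02 : 0 < cr e0 e2) (p03 : 0 < cr e0 e3)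
    (p04 : 0 < cr e0 e4) (p12 : 0 < cr e1 e2) (p13 : 0 < cr e1 e3) (p14 : 0 < cr e1 e4)
    (p23 : 0 < cr e2 e3) (p24 : 0 < cr e2 e4) (p34 : 0 < cr e3 e4)
    (m0 : e0 ∈ IntLattice) (m1 : e2 ∈ IntLattice) (m23 : e1 + e3 ∈ IntLattice)
    (m34 : e3 + e4 ∈ IntLattice) (n0 : ∃ n : ℤ, cr e0 (e1 + e2 + e3 + e4) = n)
    (n1 : ∃ n : ℤ, cr e2 (e0 + e1 - e3 - e4) = n) : 8 ≤ S10 e0 e1 e2 e3 e4 := by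
  obtain ⟨a, ha⟩ := lat_cr m0 m23
  obtain ⟨b, hb⟩ := lat_cr m0 m34
  obtain ⟨c, hc⟩ := n0
  obtain ⟨d, hd⟩ := lat_cr m0 m1
  obtain ⟨a', ha'⟩ := lat_cr m1 m23
  obtain ⟨b', hb'⟩ := lat_cr m1 m34
  obtain ⟨c', hc'⟩ := n1
  have hx := lat_cr_one m23 m34 (by
    simp only [cr_add_left, cr_add_right, cr_self]; linarith)
  simp only [cr_add_left, cr_add_right, cr_self, cr_sub_right] at *
  rw [cr_swap e2 e0, cr_swap e2 e1] at hc'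
  rw [cr_swap e2 e1] at ha'
  have q1 : 1 ≤ cr e0 e4 := one_le_of_int ⟨c - d - a, by push_cast; linarith⟩ p04
  have q2 : 1 ≤ cr e0 e1 := one_le_of_int ⟨c - d - b, by push_cast; linarith⟩ p01
  have q3 : 1 ≤ cr e0 e3 := one_le_of_int ⟨a + b - c + d, by push_cast; linarith⟩ p03
  have q1' : 1 ≤ cr e1 e2 := one_le_of_int ⟨- c' - d - b', by push_cast; linarith⟩ p12
  have q2' : 1 ≤ cr e2 e3 := one_le_of_int ⟨- c' - d - b' + a', by push_cast; linarith⟩ p23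
  have q3' : 1 ≤ cr e2 e4 := one_le_of_int ⟨b' - (- c' - d - b' + a'), by push_cast; linarith⟩ p24
  have q4 : 1 ≤ cr e0 e2 := one_le_of_int ⟨d, hd⟩ p02
  unfold S10; linarith

namespace Dec
variable {v : ZMod 10 → Pt}

def ar (v : ZMod 10 → Pt) (i : ZMod 10) : ℝ :=
  S10 (ed v i) (ed v (i+1)) (ed v (i+2)) (ed v (i+3)) (ed v (i+4))

lemma ar_step (H : Dec v) (i : ZMod 10) : ar v (i+1) = ar v i := by
  unfold ar
  rw [show i + 1 + 1 = i + 2 by ring, show i + 1 + 2 = i + 3 by ring, show i + 1 + 3 = i + 4 by ring,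
    show i + 1 + 4 = i + 5 by ring, H.ed_opp]
  simp only [S10, cr]
  simp only [Prod.fst_neg, Prod.snd_neg]
  ring

lemma ar_zero (H : Dec v) : ar v 0 = area v := by
  have h5 : v 5 = - v 0 := H.opp 0
  have c1 : (0:ZMod 10) + 1 = 1 := rfl
  have c2 : (0:ZMod 10) + 2 = 2 := rfl
  have c3 : (0:ZMod 10) + 3 = 3 := rfl
  have c4 : (0:ZMod 10) + 4 = 4 := rfl
  have d1 : (1:ZMod 10) + 1 = 2 := rfl
  have d2 : (2:ZMod 10) + 1 = 3 := rfl
  have d3 : (3:ZMod 10) + 1 = 4 := rfl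
  have d4 : (4:ZMod 10) + 1 = 5 := rfl
  simp only [ar, area, S10, ed, c1, c2, c3, c4, d1, d2, d3, d4, h5, cr, Prod.fst_sub, Prod.snd_sub,
    Prod.fst_neg, Prod.snd_neg]
  ring

lemma ar_eq (H : Dec v) (i : ZMod 10) : ar v i = area v := by
  have : ∀ n : ℕ, ar v (n : ZMod 10) = area v := by
    intro n
    induction n with
    | zero => simpa using H.ar_zero
    | succ n ih => rw [Nat.cast_succ, H.ar_step, ih]
  have h := this i.val
  rwa [ZMod.natCast_zmod_val] at h

lemma sum_ed (H : Dec v) (i : ZMod 10) :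
    ed v i + ed v (i+1) + ed v (i+2) + ed v (i+3) + ed v (i+4) = -(v i + v i) := by
  have h5 := H.opp i
  simp only [ed]
  rw [show i + 1 + 1 = i + 2 by ring, show i + 2 + 1 = i + 3 by ring, show i + 3 + 1 = i + 4 by ring,
    show i + 4 + 1 = i + 5 by ring, h5]
  abel

lemma pos10 (H : Dec v) (i : ZMod 10) :
    0 < cr (ed v i) (ed v (i+1)) ∧ 0 < cr (ed v i) (ed v (i+2)) ∧ 0 < cr (ed v i) (ed v (i+3)) ∧
    0 < cr (ed v i) (ed v (i+4)) ∧ 0 < cr (ed v (i+1)) (ed v (i+2)) ∧ 0 < cr (ed v (i+1)) (ed v (i+3)) ∧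
    0 < cr (ed v (i+1)) (ed v (i+4)) ∧ 0 < cr (ed v (i+2)) (ed v (i+3)) ∧
    0 < cr (ed v (i+2)) (ed v (i+4)) ∧ 0 < cr (ed v (i+3)) (ed v (i+4)) := by
  have a := H.cr1 (i+1); have b := H.cr2 (i+1); have c := H.cr3 (i+1)
  have d := H.cr1 (i+2); have e := H.cr2 (i+2); have f := H.cr1 (i+3)
  rw [show i + 1 + 1 = i + 2 by ring] at a
  rw [show i + 1 + 2 = i + 3 by ring] at b
  rw [show i + 1 + 3 = i + 4 by ring] at c
  rw [show i + 2 + 1 = i + 3 by ring] at d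
  rw [show i + 2 + 2 = i + 4 by ring] at e
  rw [show i + 3 + 1 = i + 4 by ring] at f
  exact ⟨H.cr1 i, H.cr2 i, H.cr3 i, H.cr4 i, a, b, c, d, e, f⟩

/-- exceptional edge -/
def Exc (v : ZMod 10 → Pt) (i : ZMod 10) : Prop :=
  ed v i ∈ IntLattice ∧ ∃ n : ℤ, cr (ed v i) (v i + v (i+1)) = n

def Reg (v : ZMod 10 → Pt) (i : ZMod 10) : Prop := v i + v (i+1) ∈ IntLattice

lemma reg_opp (H : Dec v) {i : ZMod 10} : Reg v (i+5) ↔ Reg v i := by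
  unfold Reg
  rw [show i + 5 + 1 = i + 1 + 5 by ring, H.opp, H.opp, ← neg_add, lat_neg_iff]

lemma exc_opp (H : Dec v) {i : ZMod 10} (h : Exc v i) : Exc v (i+5) := by
  obtain ⟨h1, n, h2⟩ := h
  refine ⟨by rw [H.ed_opp]; exact lat_neg h1, n, ?_⟩
  rw [H.ed_opp, show i + 5 + 1 = i + 1 + 5 by ring, H.opp, H.opp, ← neg_add, cr_neg_left, cr_neg_right,
    neg_neg, h2]

lemma reg_sum {i : ZMod 10} (h : Reg v i) (h' : Reg v (i+1)) : ed v i + ed v (i+1) ∈ IntLattice := by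
  have := lat_sub h' h
  convert this using 1
  simp only [ed]; abel

lemma adj_case (H : Dec v) {i : ZMod 10} (h0 : Exc v i) (h1 : Exc v (i+1)) (h2 : Reg v (i+2))
    (h3 : Reg v (i+3)) (h4 : Reg v (i+4)) : 8 ≤ area v := by
  rw [← H.ar_eq i]
  obtain ⟨p1, p2, p3, p4, p5, p6, p7, p8, p9, p10⟩ := H.pos10 i
  have h3' : Reg v (i+2+1) := by rwa [show i + 2 + 1 = i + 3 by ring]
  have h4' : Reg v (i+3+1) := by rwa [show i + 3 + 1 = i + 4 by ring]
  have r1 := reg_sum h2 h3'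
  have r2 := reg_sum h3 h4'
  rw [show i + 2 + 1 = i + 3 by ring] at r1
  rw [show i + 3 + 1 = i + 4 by ring] at r2
  have hs := H.sum_ed i
  obtain ⟨m0, n0, hn0⟩ := h0
  obtain ⟨m1, n1, hn1⟩ := h1
  refine adj_aux _ _ _ _ _ p1 p2 p3 p4 p5 p6 p7 p8 p9 p10 m0 m1 r1 r2 ⟨-n0, ?_⟩ ⟨n1, ?_⟩
  · push_cast; rw [← hn0, ← cr_neg_right]
    congr 1
    have : v i + v (i+1) = (v i + v i) + ed v i := by simp only [ed]; abel
    rw [this, neg_add, ← hs]; abel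
  · rw [← hn1]
    congr 1
    have : v (i+1) + v (i+1+1) = (v i + v i) + ed v i + ed v i + ed v (i+1) := by simp only [ed]; abel
    rw [this, ← neg_neg (v i + v i), ← hs]; abel

lemma dist_case (H : Dec v) {i : ZMod 10} (h0 : Exc v i) (h1 : Reg v (i+1)) (h2 : Exc v (i+2))
    (h3 : Reg v (i+3)) (h4 : Reg v (i+4)) : 8 ≤ area v := by
  rw [← H.ar_eq i]
  obtain ⟨p1, p2, p3, p4, p5, p6, p7, p8, p9, p10⟩ := H.pos10 i
  have h4' : Reg v (i+3+1) := by rwa [show i + 3 + 1 = i + 4 by ring]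
  have r2 := reg_sum h3 h4'
  rw [show i + 3 + 1 = i + 4 by ring] at r2
  have hs := H.sum_ed i
  obtain ⟨m0, n0, hn0⟩ := h0
  obtain ⟨m2, n1, hn1⟩ := h2
  have e2 : i + 1 + 1 = i + 2 := by ring
  have e3 : i + 2 + 1 = i + 3 := by ring
  have e4 : i + 3 + 1 = i + 4 := by ring
  have r1 : ed v (i+1) + ed v (i+3) ∈ IntLattice := by
    have := lat_sub (lat_sub (lat_sub h3 h1) m2) m2
    convert this using 1
    simp only [ed, e2, e3, e4]; abel
  refine dist_aux _ _ _ _ _ p1 p2 p3 p4 p5 p6 p7 p8 p9 p10 m0 m2 r1 r2 ⟨-n0, ?_⟩ ⟨n1, ?_⟩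
  · push_cast; rw [← hn0, ← cr_neg_right]
    congr 1
    have : v i + v (i+1) = (v i + v i) + ed v i := by simp only [ed]; abel
    rw [this, neg_add, ← hs]; abel
  · rw [← hn1]
    have : v (i+2) + v (i+2+1) = (v i + v i) + ed v i + ed v i + ed v (i+1) + ed v (i+1) + ed v (i+2) := by
      simp only [ed, e2]; abel
    rw [this, ← neg_neg (v i + v i), ← hs]
    simp only [cr, Prod.fst_add, Prod.snd_add, Prod.fst_sub, Prod.snd_sub, Prod.fst_neg, Prod.snd_neg]
    ring

lemma four_case (H : Dec v) {i : ZMod 10} (h0 : ed v i ∈ IntLattice) (h1 : ed v (i+1) ∈ IntLattice)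
    (h2 : ed v (i+2) ∈ IntLattice) (h3 : ed v (i+3) ∈ IntLattice) : 6 < area v := by
  rw [← H.ar_eq i]
  obtain ⟨p1, p2, p3, p4, p5, p6, p7, p8, p9, p10⟩ := H.pos10 i
  have := lat_cr_one h0 h1 p1
  have := lat_cr_one h0 h2 p2
  have := lat_cr_one h0 h3 p3
  have := lat_cr_one h1 h2 p5
  have := lat_cr_one h1 h3 p6
  have := lat_cr_one h2 h3 p8
  unfold ar S10; linarith

lemma two_case (H : Dec v) (hb : ∀ i, Reg v i ∨ Exc v i) (h : v 0 + v 0 ∈ IntLattice) : 6 < area v := by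
  have step : ∀ i, v i + v i ∈ IntLattice → ed v i ∈ IntLattice ∧ v (i+1) + v (i+1) ∈ IntLattice := by
    intro i hi
    have he : ed v i ∈ IntLattice := by
      rcases hb i with h | h
      · have := lat_sub h hi
        convert this using 1
        simp only [ed]; abel
      · exact h.1
    refine ⟨he, ?_⟩
    have := lat_add (lat_add hi he) he
    convert this using 1
    simp only [ed]; abel
  obtain ⟨a0, b0⟩ := step 0 h
  obtain ⟨a1, b1⟩ := step _ b0
  obtain ⟨a2, b2⟩ := step _ b1
  obtain ⟨a3, b3⟩ := step _ b2
  exact H.four_case (i := 0) a0 a1 a2 a3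

lemma opp_mem (H : Dec v) {i : ZMod 10} (h : ed v i ∈ IntLattice) : ed v (i+5) ∈ IntLattice := by
  rw [H.ed_opp]; exact lat_neg h

/-- difference or sum is in the lattice -/
def Cg (s : Bool) (x y : Pt) : Prop := if s then x + y ∈ IntLattice else y - x ∈ IntLattice

lemma Cg_trans {s t : Bool} {x y z : Pt} (h : Cg s x y) (h' : Cg t y z) : Cg (xor s t) x z := by
  cases s <;> cases t <;> simp only [Cg, Bool.xor_false, Bool.xor_true, Bool.not_true, Bool.not_false,
    if_true, if_false, Bool.false_eq_true] at h h' ⊢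
  · convert lat_add h h' using 1; abel
  · convert lat_sub h' h using 1; abel
  · convert lat_add h h' using 1; abel
  · convert lat_sub h' h using 1; abel

/-- all edges regular when the area is at most six -/
lemma all_reg (H : Dec v) (hb : ∀ i, Reg v i ∨ Exc v i) (hA : area v ≤ 6) (i : ZMod 10) : Reg v i := by
  have hb' : ∀ i, ∃ s : Bool, Cg s (v i) (v (i+1)) ∧ cond s (Reg v i) (Exc v i) := by
    intro i
    rcases hb i with h | h
    · exact ⟨true, h, h⟩
    · exact ⟨false, h.1, h⟩
  have fin : ∀ s : Bool, Cg s (v 0) (v 5) → s = false → False := by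
    intro s h hs
    subst hs
    have : v 5 - v 0 ∈ IntLattice := h
    rw [show v 5 = - v 0 from H.opp 0] at this
    have h2 : v 0 + v 0 ∈ IntLattice := by
      have := lat_neg this
      convert this using 1; abel
    exact absurd hA (not_le.2 (H.two_case hb h2))
  have adj : ∀ i, Exc v i → Exc v (i+1) → Reg v (i+2) → Reg v (i+3) → Reg v (i+4) → False := by
    intro i a b c d e; linarith [H.adj_case a b c d e]
  have dst : ∀ i, Exc v i → Reg v (i+1) → Exc v (i+2) → Reg v (i+3) → Reg v (i+4) → False := by
    intro i a b c d e; linarith [H.dist_case a b c d e]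
  have four : ∀ i, Exc v i → Exc v (i+1) → Exc v (i+2) → Exc v (i+3) → False := by
    intro i a b c d; linarith [H.four_case a.1 b.1 c.1 d.1]
  have ro : ∀ i, Reg v i → Reg v (i+5) := fun i h => H.reg_opp.2 h
  have eo : ∀ i, Exc v i → Exc v (i+5) := fun i h => H.exc_opp h
  have main : Reg v 0 ∧ Reg v 1 ∧ Reg v 2 ∧ Reg v 3 ∧ Reg v 4 := by
    obtain ⟨s0, k0, h0⟩ := hb' 0
    obtain ⟨s1, k1, h1⟩ := hb' 1
    obtain ⟨s2, k2, h2⟩ := hb' 2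
    obtain ⟨s3, k3, h3⟩ := hb' 3
    obtain ⟨s4, k4, h4⟩ := hb' 4
    have F := fin _ (Cg_trans (Cg_trans (Cg_trans (Cg_trans k0 k1) k2) k3) k4)
    clear k0 k1 k2 k3 k4
    rcases s0 with _ | _ <;> rcases s1 with _ | _ <;> rcases s2 with _ | _ <;> 
    rcases s3 with _ | _ <;> rcases s4 with _ | _ <;> 
    first
    | exact ⟨h0, h1, h2, h3, h4⟩
    | exact (adj 0 h0 h1 h2 h3 h4).elim
    | exact (adj 1 h1 h2 h3 h4 (ro 0 h0)).elim
    | exact (adj 2 h2 h3 h4 (ro 0 h0) (ro 1 h1)).elim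
    | exact (adj 3 h3 h4 (eo 0 h0) (ro 1 h1) (ro 2 h2)).elim
    | exact (adj 3 h3 h4 (ro 0 h0) (ro 1 h1) (ro 2 h2)).elim
    | exact (adj 4 h4 (eo 0 h0) (ro 1 h1) (ro 2 h2) (ro 3 h3)).elim
    | exact (dst 0 h0 h1 h2 h3 h4).elim
    | exact (dst 1 h1 h2 h3 h4 (ro 0 h0)).elim
    | exact (dst 2 h2 h3 h4 (ro 0 h0) (ro 1 h1)).elim
    | exact (dst 3 h3 h4 (eo 0 h0) (ro 1 h1) (ro 2 h2)).elim
    | exact (dst 4 h4 (ro 0 h0) (eo 1 h1) (ro 2 h2) (ro 3 h3)).elim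
    | exact (four 0 h0 h1 h2 h3).elim
    | exact (four 1 h1 h2 h3 h4).elim
    | exact (four 2 h2 h3 h4 (eo 0 h0)).elim
    | exact (four 3 h3 h4 (eo 0 h0) (eo 1 h1)).elim
    | exact (four 4 h4 (eo 0 h0) (eo 1 h1) (eo 2 h2)).elim
    | exact (F rfl).elim
  obtain ⟨m0, m1, m2, m3, m4⟩ := main
  rcases zmod10_cases i with h|h|h|h|h|h|h|h|h|h <;> subst h
  · exact m0
  · exact m1
  · exact m2
  · exact m3
  · exact m4
  · exact ro 0 m0
  · exact ro 1 m1
  · exact ro 2 m2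
  · exact ro 3 m3
  · exact ro 4 m4

end Dec

end Part7

section Part8
open Set Pointwise MeasureTheory Topology

def chk (D0 D1 D4 E0 E1 : ℕ) : Bool :=
  D0 == 0 ||
  (let E4 := D0 + E1 - D1
   let E3 := E0 + D4 - D0
   let D2 := (E0 * E1 - D1 * E3) / D0
   let D3 := (E3 * E4 - E1 * D4) / D0
   let E2 := (E0 * E4 - D1 * D4) / D0
   !(2 * (D0 + D1 + D2 + D3 + D4) + E0 + E1 + E2 + E3 + E4 == 30) || D1 == 0 || D2 == 0 || D3 == 0 ||
    D4 == 0 || E0 == 0 || E1 == 0 || E2 == 0 || E3 == 0 || E4 == 0 || !(D0 * D2 + D1 * E3 == E0 * E1) ||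
    !(D0 * D3 + E1 * D4 == E3 * E4) || !(D0 * E2 + D1 * D4 == E0 * E4) ||
    (D0 == 1 && D1 == 2 && D4 == 2 && E0 == 3 && E1 == 3) ||
    (D0 == 1 && D1 == 2 && D4 == 2 && E0 == 2 && E1 == 4) ||
    (D0 == 2 && D1 == 1 && D4 == 1 && E0 == 3 && E1 == 2) ||
    (D0 == 2 && D1 == 1 && D4 == 2 && E0 == 2 && E1 == 3) ||
    (D0 == 2 && D1 == 2 && D4 == 1 && E0 == 4 && E1 == 2))

lemma chk_all : ∀ D0 < 11, ∀ D1 < 11 - D0, ∀ D4 < 11 - D0 - D1, ∀ E0 < 24 - 2 * (D0 + D1 + D4),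
    ∀ E1 < 24 - 2 * (D0 + D1 + D4) - E0, chk D0 D1 D4 E0 E1 = true := by
  decide +kernel

lemma classify_nat (D0 D1 D2 D3 D4 E0 E1 E2 E3 E4 : ℕ) (a0 : 1 ≤ D0) (a1 : 1 ≤ D1) (a2 : 1 ≤ D2)
    (a3 : 1 ≤ D3) (a4 : 1 ≤ D4) (b0 : 1 ≤ E0) (b1 : 1 ≤ E1) (b2 : 1 ≤ E2) (b3 : 1 ≤ E3) (b4 : 1 ≤ E4)
    (hs : 2 * (D0 + D1 + D2 + D3 + D4) + E0 + E1 + E2 + E3 + E4 = 30)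
    (r1 : D0 + E1 = D1 + E4) (r2 : E0 + D4 = D0 + E3) (q1 : D0 * D2 + D1 * E3 = E0 * E1)
    (q2 : D0 * D3 + E1 * D4 = E3 * E4) (q3 : D0 * E2 + D1 * D4 = E0 * E4) :
    (D0 = 1 ∧ D1 = 2 ∧ D4 = 2 ∧ E0 = 3 ∧ E1 = 3) ∨ (D0 = 1 ∧ D1 = 2 ∧ D4 = 2 ∧ E0 = 2 ∧ E1 = 4) ∨
    (D0 = 2 ∧ D1 = 1 ∧ D4 = 1 ∧ E0 = 3 ∧ E1 = 2) ∨ (D0 = 2 ∧ D1 = 1 ∧ D4 = 2 ∧ E0 = 2 ∧ E1 = 3) ∨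
    (D0 = 2 ∧ D1 = 2 ∧ D4 = 1 ∧ E0 = 4 ∧ E1 = 2) := by
  have h := chk_all D0 (by omega) D1 (by omega) D4 (by omega) E0 (by omega) E1 (by omega)
  have e4 : D0 + E1 - D1 = E4 := by omega
  have e3 : E0 + D4 - D0 = E3 := by omega
  have d2 : (E0 * E1 - D1 * E3) / D0 = D2 := by
    rw [← q1, Nat.add_sub_cancel, Nat.mul_div_cancel_left _ a0]
  have d3 : (E3 * E4 - E1 * D4) / D0 = D3 := by
    rw [← q2, Nat.add_sub_cancel, Nat.mul_div_cancel_left _ a0]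
  have e2 : (E0 * E4 - D1 * D4) / D0 = E2 := by
    rw [← q3, Nat.add_sub_cancel, Nat.mul_div_cancel_left _ a0]
  simp only [chk, e4, e3, d2, d3, e2, hs, q1, q2, q3] at h
  clear e4 e3 d2 d3 e2 q1 q2 q3 hs r1 r2
  simp only [Bool.or_eq_true, Bool.and_eq_true, beq_iff_eq, beq_self_eq_true, Bool.not_true,
    Bool.false_eq_true, false_or] at h
  simp only [Nat.one_le_iff_ne_zero] at a0 a1 a2 a3 a4 b0 b1 b2 b3 b4
  simp only [a0, a1, a2, a3, a4, b0, b1, b2, b3, b4, false_or, or_assoc, and_assoc] at h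
  exact h

lemma classify (d0 d1 d2 d3 d4 : Pt) (l0 : d0 ∈ IntLattice) (l1 : d1 ∈ IntLattice) (l2 : d2 ∈ IntLattice)
    (l3 : d3 ∈ IntLattice) (l4 : d4 ∈ IntLattice) (hrel : d0 + d2 + d4 = d1 + d3)
    (a0 : 0 < cr d0 d1) (a1 : 0 < cr d1 d2) (a2 : 0 < cr d2 d3) (a3 : 0 < cr d3 d4) (a4 : 0 < cr d0 d4)
    (b0 : 0 < cr d0 d2) (b1 : 0 < cr d1 d3) (b2 : 0 < cr d2 d4) (b3 : 0 < cr d0 d3) (b4 : 0 < cr d1 d4)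
    (hs : 2 * (cr d0 d1 + cr d1 d2 + cr d2 d3 + cr d3 d4 + cr d0 d4) + cr d0 d2 + cr d1 d3 + cr d2 d4 +
      cr d0 d3 + cr d1 d4 = 30) :
    (cr d0 d1 = 1 ∧ cr d1 d2 = 2 ∧ cr d0 d4 = 2 ∧ cr d0 d2 = 3 ∧ cr d1 d3 = 3) ∨
    (cr d0 d1 = 1 ∧ cr d1 d2 = 2 ∧ cr d0 d4 = 2 ∧ cr d0 d2 = 2 ∧ cr d1 d3 = 4) ∨
    (cr d0 d1 = 2 ∧ cr d1 d2 = 1 ∧ cr d0 d4 = 1 ∧ cr d0 d2 = 3 ∧ cr d1 d3 = 2) ∨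
    (cr d0 d1 = 2 ∧ cr d1 d2 = 1 ∧ cr d0 d4 = 2 ∧ cr d0 d2 = 2 ∧ cr d1 d3 = 3) ∨
    (cr d0 d1 = 2 ∧ cr d1 d2 = 2 ∧ cr d0 d4 = 1 ∧ cr d0 d2 = 4 ∧ cr d1 d3 = 2) := by
  have nat : ∀ x y, x ∈ IntLattice → y ∈ IntLattice → 0 < cr x y → ∃ n : ℕ, 1 ≤ n ∧ cr x y = n := by
    intro x y hx hy h
    obtain ⟨n, hn⟩ := lat_cr hx hy
    rw [hn] at h ⊢
    have : 0 < n := by exact_mod_cast h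
    refine ⟨n.toNat, by omega, ?_⟩
    have : ((n.toNat : ℤ) : ℝ) = n := by rw [Int.toNat_of_nonneg this.le]
    rw [← this, Int.cast_natCast]
  have r1 : cr d0 d1 + cr d1 d3 = cr d1 d2 + cr d1 d4 := by
    have : cr d1 (d0 + d2 + d4) = cr d1 (d1 + d3) := by rw [hrel]
    simp only [cr_add_right, cr_self] at this
    rw [cr_swap d1 d0] at this; linarith
  have r2 : cr d0 d2 + cr d0 d4 = cr d0 d1 + cr d0 d3 := by
    have : cr d0 (d0 + d2 + d4) = cr d0 (d1 + d3) := by rw [hrel]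
    simp only [cr_add_right, cr_self] at this
    linarith
  have q1 : cr d0 d1 * cr d2 d3 + cr d1 d2 * cr d0 d3 = cr d0 d2 * cr d1 d3 := by simp only [cr]; ring
  have q2 : cr d0 d1 * cr d3 d4 + cr d1 d3 * cr d0 d4 = cr d0 d3 * cr d1 d4 := by simp only [cr]; ring
  have q3 : cr d0 d1 * cr d2 d4 + cr d1 d2 * cr d0 d4 = cr d0 d2 * cr d1 d4 := by simp only [cr]; ring
  obtain ⟨D0, x0, h0⟩ := nat _ _ l0 l1 a0
  obtain ⟨D1, x1, h1⟩ := nat _ _ l1 l2 a1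
  obtain ⟨D2, x2, h2⟩ := nat _ _ l2 l3 a2
  obtain ⟨D3, x3, h3⟩ := nat _ _ l3 l4 a3
  obtain ⟨D4, x4, h4⟩ := nat _ _ l0 l4 a4
  obtain ⟨E0, y0, k0⟩ := nat _ _ l0 l2 b0
  obtain ⟨E1, y1, k1⟩ := nat _ _ l1 l3 b1
  obtain ⟨E2, y2, k2⟩ := nat _ _ l2 l4 b2
  obtain ⟨E3, y3, k3⟩ := nat _ _ l0 l3 b3
  obtain ⟨E4, y4, k4⟩ := nat _ _ l1 l4 b4
  rw [h0, h1, h2, h3, h4, k0, k1, k2, k3, k4] at hs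
  rw [h0, h1, k1, k4] at r1
  rw [h0, h4, k0, k3] at r2
  rw [h0, h1, h2, k0, k1, k3] at q1
  rw [h0, h3, h4, k1, k3, k4] at q2
  rw [h0, h1, h4, k0, k2, k4] at q3
  have := classify_nat D0 D1 D2 D3 D4 E0 E1 E2 E3 E4 x0 x1 x2 x3 x4 y0 y1 y2 y3 y4
    (by exact_mod_cast hs) (by exact_mod_cast r1) (by exact_mod_cast r2) (by exact_mod_cast q1)
    (by exact_mod_cast q2) (by exact_mod_cast q3)
  rw [h0, h1, h4, k0, k1]
  exact_mod_cast this

namespace Dec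
variable {v : ZMod 10 → Pt}

/-- sums of consecutive edges -/
def dd (v : ZMod 10 → Pt) (i : ZMod 10) : Pt := ed v i + ed v (i+1)

def ww (v : ZMod 10 → Pt) (i : ZMod 10) : Pt := v i + v (i+1)

lemma ww_opp (H : Dec v) (i : ZMod 10) : ww v (i+5) = - ww v i := by
  unfold ww; rw [show i + 5 + 1 = i + 1 + 5 by ring, H.opp, H.opp, neg_add]

lemma ww_succ (v : ZMod 10 → Pt) (i : ZMod 10) : ww v (i+1) = ww v i + dd v i := by
  simp only [ww, dd, ed]; abel

lemma dd_opp (H : Dec v) (i : ZMod 10) : dd v (i+5) = - dd v i := by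
  unfold dd; rw [show i + 5 + 1 = i + 1 + 5 by ring, H.ed_opp, H.ed_opp, neg_add]

lemma dd_rel (H : Dec v) (i : ZMod 10) : dd v i + dd v (i+2) + dd v (i+4) = dd v (i+1) + dd v (i+3) := by
  unfold dd
  rw [show i + 4 + 1 = i + 5 by ring, H.ed_opp, show i + 1 + 1 = i + 2 by ring,
    show i + 2 + 1 = i + 3 by ring, show i + 3 + 1 = i + 4 by ring]
  abel

lemma ww_dd (H : Dec v) (i : ZMod 10) : ww v i = - (dd v (i+1) + dd v (i+3)) := by
  have h := H.ww_opp i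
  rw [show i + 5 = i + 1 + 1 + 1 + 1 + 1 by ring, ww_succ, ww_succ, ww_succ, ww_succ, ww_succ] at h
  have r := H.dd_rel i
  rw [show i + 1 + 1 = i + 2 by ring, show i + 2 + 1 = i + 3 by ring, show i + 3 + 1 = i + 4 by ring] at h
  have : (2:ℝ) • ww v i = (2:ℝ) • (- (dd v (i+1) + dd v (i+3))) := by
    rw [two_smul, two_smul]
    have h' : ww v i + ww v i = - ((dd v i + dd v (i+2) + dd v (i+4)) + (dd v (i+1) + dd v (i+3))) := by
      rw [← sub_eq_zero] at h ⊢
      rw [← h]; abel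
    rw [h', r]; abel
  exact smul_right_injective Pt (two_ne_zero (α := ℝ)) this

lemma dd_mem (hr : ∀ i, Reg v i) (i : ZMod 10) : dd v i ∈ IntLattice := reg_sum (hr i) (hr (i+1))

lemma ddcr (H : Dec v) (i : ZMod 10) : 0 < cr (dd v i) (dd v (i+1)) ∧ 0 < cr (dd v i) (dd v (i+2)) ∧
    0 < cr (dd v i) (dd v (i+3)) ∧ 0 < cr (dd v i) (dd v (i+4)) := by
  obtain ⟨p1, p2, p3, p4, p5, p6, p7, p8, p9, p10⟩ := H.pos10 i
  unfold dd
  rw [show i + 4 + 1 = i + 5 by ring, H.ed_opp, show i + 1 + 1 = i + 2 by ring,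
    show i + 2 + 1 = i + 3 by ring, show i + 3 + 1 = i + 4 by ring]
  simp only [cr_add_left, cr_add_right, cr_neg_right, cr_self]
  rw [cr_swap (ed v (i+1)) (ed v i)]
  refine ⟨?_, ?_, ?_, ?_⟩ <;> linarith

lemma classify_rot (H : Dec v) (hr : ∀ i, Reg v i) (hA : area v = 6) :
    ∃ i, cr (dd v i) (dd v (i+1)) = 1 ∧ cr (dd v (i+1)) (dd v (i+2)) = 2 ∧ cr (dd v i) (dd v (i+2)) = 3 ∧
      cr (dd v (i+1)) (dd v (i+3)) = 3 ∧ cr (dd v i) (dd v (i+3)) = 4 := by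
  have c0 := H.ddcr 0; have c1 := H.ddcr 1; have c2 := H.ddcr 2; have c3 := H.ddcr 3
  simp only [show (0:ZMod 10) + 1 = 1 from rfl, show (0:ZMod 10) + 2 = 2 from rfl,
    show (0:ZMod 10) + 3 = 3 from rfl, show (0:ZMod 10) + 4 = 4 from rfl, show (1:ZMod 10) + 1 = 2 from rfl,
    show (1:ZMod 10) + 2 = 3 from rfl, show (1:ZMod 10) + 3 = 4 from rfl, show (2:ZMod 10) + 1 = 3 from rfl,
    show (2:ZMod 10) + 2 = 4 from rfl, show (3:ZMod 10) + 1 = 4 from rfl] at c0 c1 c2 c3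
  have hrel : dd v 0 + dd v 2 + dd v 4 = dd v 1 + dd v 3 := H.dd_rel 0
  have hsum : 2 * (cr (dd v 0) (dd v 1) + cr (dd v 1) (dd v 2) + cr (dd v 2) (dd v 3) + cr (dd v 3) (dd v 4) +
      cr (dd v 0) (dd v 4)) + cr (dd v 0) (dd v 2) + cr (dd v 1) (dd v 3) + cr (dd v 2) (dd v 4) +
      cr (dd v 0) (dd v 3) + cr (dd v 1) (dd v 4) = 30 := by
    rw [← H.ar_eq 0] at hA
    have h5 : ed v 5 = - ed v 0 := H.ed_opp 0
    unfold ar S10 at hA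
    simp only [dd]
    simp only [show (0:ZMod 10) + 1 = 1 from rfl, show (0:ZMod 10) + 2 = 2 from rfl,
      show (0:ZMod 10) + 3 = 3 from rfl, show (0:ZMod 10) + 4 = 4 from rfl, show (1:ZMod 10) + 1 = 2 from rfl,
      show (2:ZMod 10) + 1 = 3 from rfl, show (3:ZMod 10) + 1 = 4 from rfl,
      show (4:ZMod 10) + 1 = 5 from rfl, h5] at hA ⊢
    simp only [cr, Prod.fst_add, Prod.snd_add, Prod.fst_neg, Prod.snd_neg] at hA ⊢
    linear_combination 5 * hA
  have cl := classify (dd v 0) (dd v 1) (dd v 2) (dd v 3) (dd v 4) (dd_mem hr 0) (dd_mem hr 1) (dd_mem hr 2)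
    (dd_mem hr 3) (dd_mem hr 4) hrel c0.1 c1.1 c2.1 c3.1 c0.2.2.2 c0.2.1 c1.2.1 c2.2.1 c0.2.2.1 c1.2.2.1 hsum
  have r1 : cr (dd v 0) (dd v 1) + cr (dd v 1) (dd v 3) = cr (dd v 1) (dd v 2) + cr (dd v 1) (dd v 4) := by
    have : cr (dd v 1) (dd v 0 + dd v 2 + dd v 4) = cr (dd v 1) (dd v 1 + dd v 3) := by rw [hrel]
    simp only [cr_add_right, cr_self] at this
    rw [cr_swap (dd v 1) (dd v 0)] at this; linarith
  have r2 : cr (dd v 0) (dd v 2) + cr (dd v 0) (dd v 4) = cr (dd v 0) (dd v 1) + cr (dd v 0) (dd v 3) := by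
    have : cr (dd v 0) (dd v 0 + dd v 2 + dd v 4) = cr (dd v 0) (dd v 1 + dd v 3) := by rw [hrel]
    simp only [cr_add_right, cr_self] at this
    linarith
  have q1 : cr (dd v 0) (dd v 1) * cr (dd v 2) (dd v 3) + cr (dd v 1) (dd v 2) * cr (dd v 0) (dd v 3) =
    cr (dd v 0) (dd v 2) * cr (dd v 1) (dd v 3) := by simp only [cr]; ring
  have q2 : cr (dd v 0) (dd v 1) * cr (dd v 3) (dd v 4) + cr (dd v 1) (dd v 3) * cr (dd v 0) (dd v 4) =
    cr (dd v 0) (dd v 3) * cr (dd v 1) (dd v 4) := by simp only [cr]; ring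
  have q3 : cr (dd v 0) (dd v 1) * cr (dd v 2) (dd v 4) + cr (dd v 1) (dd v 2) * cr (dd v 0) (dd v 4) =
    cr (dd v 0) (dd v 2) * cr (dd v 1) (dd v 4) := by simp only [cr]; ring
  have o5 : dd v 5 = - dd v 0 := H.dd_opp 0
  have o6 : dd v 6 = - dd v 1 := H.dd_opp 1
  have o7 : dd v 7 = - dd v 2 := H.dd_opp 2
  rcases cl with ⟨a, b, c, d, e⟩ | ⟨a, b, c, d, e⟩ | ⟨a, b, c, d, e⟩ | ⟨a, b, c, d, e⟩ | ⟨a, b, c, d, e⟩ <;>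
    rw [a, b, e] at r1 <;> rw [a, c, d] at r2 <;> rw [a, b, d, e] at q1 <;> rw [a, c, e] at q2 <;>
    rw [a, b, c, d] at q3
  · refine ⟨0, a, b, d, e, ?_⟩
    change cr (dd v 0) (dd v 3) = 4
    linarith
  · have f3 : cr (dd v 0) (dd v 3) = 3 := by linarith
    have f4 : cr (dd v 1) (dd v 4) = 3 := by linarith
    rw [f3] at q1 q2; rw [f4] at q2 q3
    refine ⟨3, ?_, ?_, ?_, ?_, ?_⟩
    · change cr (dd v 3) (dd v 4) = 1; linarith
    · change cr (dd v 4) (dd v 5) = 2; rw [o5, cr_neg_right, ← cr_swap]; linarith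
    · change cr (dd v 3) (dd v 5) = 3; rw [o5, cr_neg_right, ← cr_swap]; linarith
    · change cr (dd v 4) (dd v 6) = 3; rw [o6, cr_neg_right, ← cr_swap]; linarith
    · change cr (dd v 3) (dd v 6) = 4; rw [o6, cr_neg_right, ← cr_swap]; linarith
  · have f3 : cr (dd v 0) (dd v 3) = 2 := by linarith
    have f4 : cr (dd v 1) (dd v 4) = 3 := by linarith
    rw [f3] at q1 q2; rw [f4] at q2 q3
    refine ⟨4, ?_, ?_, ?_, ?_, ?_⟩
    · change cr (dd v 4) (dd v 5) = 1; rw [o5, cr_neg_right, ← cr_swap]; linarith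
    · change cr (dd v 5) (dd v 6) = 2; rw [o5, o6, cr_neg_right, cr_neg_left, neg_neg]; linarith
    · change cr (dd v 4) (dd v 6) = 3; rw [o6, cr_neg_right, ← cr_swap]; linarith
    · change cr (dd v 5) (dd v 7) = 3; rw [o5, o7, cr_neg_right, cr_neg_left, neg_neg]; linarith
    · change cr (dd v 4) (dd v 7) = 4; rw [o7, cr_neg_right, ← cr_swap]; linarith
  · have f3 : cr (dd v 0) (dd v 3) = 2 := by linarith
    have f4 : cr (dd v 1) (dd v 4) = 4 := by linarith
    rw [f3] at q1 q2; rw [f4] at q2 q3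
    refine ⟨1, ?_, ?_, ?_, ?_, ?_⟩
    · change cr (dd v 1) (dd v 2) = 1; linarith
    · change cr (dd v 2) (dd v 3) = 2; linarith
    · change cr (dd v 1) (dd v 3) = 3; linarith
    · change cr (dd v 2) (dd v 4) = 3; linarith
    · change cr (dd v 1) (dd v 4) = 4; linarith
  · have f3 : cr (dd v 0) (dd v 3) = 3 := by linarith
    have f4 : cr (dd v 1) (dd v 4) = 2 := by linarith
    rw [f3] at q1 q2; rw [f4] at q2 q3
    refine ⟨2, ?_, ?_, ?_, ?_, ?_⟩
    · change cr (dd v 2) (dd v 3) = 1; linarith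
    · change cr (dd v 3) (dd v 4) = 2; linarith
    · change cr (dd v 2) (dd v 4) = 3; linarith
    · change cr (dd v 3) (dd v 5) = 3; rw [o5, cr_neg_right, ← cr_swap]; linarith
    · change cr (dd v 2) (dd v 5) = 4; rw [o5, cr_neg_right, ← cr_swap]; linarith

end Dec

end Part8

section Part9
open Set Pointwise MeasureTheory Topology

namespace Dec
variable {v : ZMod 10 → Pt}

lemma near_pos (H : Dec v) (x : Pt) : ∀ᶠ y in 𝓝 x, ∀ l ∈ IntLattice, x - l ∈ DPoly v → ∀ j : ZMod 10,
      0 < g v j (x - l) → 0 < g v j (y - l) := by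
  have hfin := inc_fin H.bounded_poly x
  have e2 : ∀ᶠ y in 𝓝 x, ∀ l ∈ {l ∈ IntLattice | x - l ∈ DPoly v}, ∀ j : ZMod 10,
      0 < g v j (x - l) → 0 < g v j (y - l) := by
    rw [Filter.eventually_all_finite hfin]
    intro l _
    rw [Filter.eventually_all]
    intro j
    by_cases h : 0 < g v j (x - l)
    · have hc : Continuous fun y => g v j (y - l) := (g_cont v j).comp (by fun_prop)
      filter_upwards [hc.continuousAt.eventually (lt_mem_nhds h)] with y hy _ using hy
    · exact Filter.Eventually.of_forall fun _ h' => absurd h' h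
  filter_upwards [e2] with y hy l hl hx
  exact hy l ⟨hl, hx⟩

open Classical in
/-- weight of a point: one inside, one half on the boundary -/
def phi (v : ZMod 10 → Pt) (p : Pt) : ℝ :=
  if ∀ j, 0 < g v j p then 1 else if ∀ j, 0 ≤ g v j p then 1/2 else 0

def LL (H : Dec v) (x : Pt) : Finset Pt := (inc_fin H.bounded_poly x).toFinset

lemma mem_LL (H : Dec v) (x l : Pt) : l ∈ H.LL x ↔ l ∈ IntLattice ∧ x - l ∈ DPoly v := by
  unfold LL; rw [Set.Finite.mem_toFinset]; rfl

def GG (H : Dec v) (x : Pt) : ℝ := ∑ l ∈ H.LL x, phi v (x - l)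

/-- points which are not lattice translates of vertices -/
def XX (v : ZMod 10 → Pt) : Set Pt := (⋃ l ∈ IntLattice, range fun j => v j + l)ᶜ

lemma XX_iff (x : Pt) : x ∈ XX v ↔ ∀ l ∈ IntLattice, ∀ j, x - l ≠ v j := by
  unfold XX
  simp only [mem_compl_iff, mem_iUnion, mem_range, not_exists]
  constructor
  · intro h l hl j hj
    exact h l hl j (by rw [← hj]; abel)
  · intro h l hl j hj
    exact h l hl j (by rw [← hj]; abel)

lemma XX_countable (v : ZMod 10 → Pt) : (XX v)ᶜ.Countable := by
  unfold XX; rw [compl_compl]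
  exact lat_countable.biUnion fun l _ => countable_range _

lemma edge_uniq (H : Dec v) {x l : Pt} (hx : x ∈ XX v) (hl : l ∈ IntLattice) (hm : x - l ∈ DPoly v)
    {i : ZMod 10} (hi : g v i (x - l) = 0) :
    (∀ j, j ≠ i → 0 < g v j (x - l)) ∧
      (x - (l + ww v i) ∈ DPoly v ∧ g v (i+5) (x - (l + ww v i)) = 0) := by
  obtain ⟨t, t0, t1, ht⟩ := H.face hm hi
  have hx' := (XX_iff x).1 hx l hl
  have t0' : 0 < t := by
    rcases t0.lt_or_eq with h | h
    · exact h
    · exfalso; apply hx' i; rw [ht, ← h, zero_smul, add_zero]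
  have t1' : t < 1 := by
    rcases t1.lt_or_eq with h | h
    · exact h
    · exfalso; apply hx' (i+1); rw [ht, h, one_smul]; abel
  constructor
  · intro j hj; rw [ht]; exact H.g_edge_pos hj t0' t1'
  · have := H.mem_edge (i+5) (1 - t) (by linarith) (by linarith)
    have e : x - (l + ww v i) = v (i+5) + (1 - t) • ed v (i+5) := by
      rw [← sub_sub, ht, H.opp, H.ed_opp, sub_smul, one_smul, ww, smul_neg]
      simp only [ed]; abel
    rw [e]; exact this

lemma g_ww (H : Dec v) (i : ZMod 10) (y l : Pt) : g v (i+5) (y - (l + ww v i)) = - g v i (y - l) := by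
  have := H.g_opp i (-(y - (l + ww v i)))
  rw [neg_neg] at this
  rw [this]
  simp only [g, ww, cr, Prod.fst_sub, Prod.snd_sub, Prod.fst_add, Prod.snd_add, Prod.fst_neg, Prod.snd_neg]
  ring

lemma phi_edge {y l : Pt} {i : ZMod 10} (h : ∀ j, j ≠ i → 0 < g v j (y - l)) :
    (0 < g v i (y - l) → phi v (y - l) = 1) ∧ (g v i (y - l) = 0 → phi v (y - l) = 1/2) ∧
    (g v i (y - l) < 0 → phi v (y - l) = 0) := by
  have key : ∀ j, j = i ∨ 0 < g v j (y - l) := fun j => by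
    by_cases hj : j = i
    · left; exact hj
    · right; exact h j hj
  refine ⟨fun h' => ?_, fun h' => ?_, fun h' => ?_⟩
  · rw [phi, if_pos]
    intro j; rcases key j with rfl | h
    · exact h'
    · exact h
  · rw [phi, if_neg, if_pos]
    · intro j; rcases key j with rfl | h
      · exact h'.ge
      · exact h.le
    · intro hc; exact absurd h' (hc i).ne'
  · rw [phi, if_neg, if_neg]
    · intro hc; exact absurd h' (not_lt.2 (hc i))
    · intro hc; exact absurd h' (not_lt.2 (hc i).le)

lemma ne5 (i : ZMod 10) : i + 5 ≠ i := by revert i; decide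

open Classical in
lemma loc_const (H : Dec v) (hr : ∀ i, Reg v i) {x : Pt} (hx : x ∈ XX v) :
    ∀ᶠ y in 𝓝 x, H.GG y = H.GG x := by
  filter_upwards [near H.bounded_poly (closed_poly v) x, H.near_pos x] with y h1 h2
  have hsub : H.LL y ⊆ H.LL x := by
    intro l hl
    rw [mem_LL] at hl ⊢
    exact ⟨hl.1, h1 l hl.1 hl.2⟩
  have e1 : H.GG y = ∑ l ∈ H.LL x, phi v (y - l) := by
    refine Finset.sum_subset hsub fun l hl hl' => ?_
    rw [mem_LL] at hl hl'
    have hn : ¬ ∀ j, 0 ≤ g v j (y - l) := fun hc => hl' ⟨hl.1, hc⟩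
    rw [phi, if_neg, if_neg hn]
    exact fun hc => hn fun j => (hc j).le
  rw [e1, GG, ← sub_eq_zero, ← Finset.sum_sub_distrib]
  -- facts about boundary incidences
  have fact : ∀ l ∈ H.LL x, ∀ i, g v i (x - l) = 0 →
      (phi v (x - l) = 1/2 ∧ (∀ j, j ≠ i → 0 < g v j (x - l)) ∧ (∀ j, j ≠ i → 0 < g v j (y - l)) ∧
        l + ww v i ∈ H.LL x ∧ g v (i+5) (x - (l + ww v i)) = 0) := by
    intro l hl i hi
    rw [mem_LL] at hl
    obtain ⟨u1, u2, u3⟩ := H.edge_uniq hx hl.1 hl.2 hi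
    refine ⟨(phi_edge u1).2.1 hi, u1, fun j hj => h2 l hl.1 hl.2 j (u1 j hj), ?_, u3⟩
    rw [mem_LL]
    exact ⟨lat_add hl.1 (hr i), u2⟩
  let ι : (l : Pt) → l ∈ H.LL x → Pt := fun l _ =>
    if h : ∃ i, g v i (x - l) = 0 then l + ww v h.choose else l
  refine Finset.sum_involution ι ?_ ?_ ?_ ?_
  · intro l hl
    by_cases h : ∃ i, g v i (x - l) = 0
    · simp only [ι, dif_pos h]
      set i := h.choose
      have hi : g v i (x - l) = 0 := h.choose_spec
      obtain ⟨a1, a2, a3, a4, a5⟩ := fact l hl i hi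
      obtain ⟨b1, b2, b3, b4, b5⟩ := fact _ a4 (i+5) a5
      rw [a1, b1]
      have hg := H.g_ww i y l
      obtain ⟨c1, c2, c3⟩ := phi_edge a3
      obtain ⟨d1, d2, d3⟩ := phi_edge b3
      rcases lt_trichotomy (g v i (y - l)) 0 with h | h | h
      · rw [c3 h, d1 (by linarith)]; norm_num
      · rw [c2 h, d2 (by linarith)]; norm_num
      · rw [c1 h, d3 (by linarith)]; norm_num
    · simp only [ι, dif_neg h]
      have hl' := (H.mem_LL x l).1 hl
      push Not at h
      have p1 : ∀ j, 0 < g v j (x - l) := fun j => lt_of_le_of_ne (hl'.2 j) (h j).symm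
      have p2 : ∀ j, 0 < g v j (y - l) := fun j => h2 l hl'.1 hl'.2 j (p1 j)
      rw [phi, if_pos p2, phi, if_pos p1]; norm_num
  · intro l hl hne
    by_cases h : ∃ i, g v i (x - l) = 0
    · simp only [ι, dif_pos h]
      set i := h.choose
      have hi : g v i (x - l) = 0 := h.choose_spec
      obtain ⟨a1, a2, a3, a4, a5⟩ := fact l hl i hi
      intro heq
      rw [heq] at a5
      exact absurd a5 (a2 (i+5) (ne5 i)).ne'
    · exfalso; apply hne
      have hl' := (H.mem_LL x l).1 hl
      push Not at h
      have p1 : ∀ j, 0 < g v j (x - l) := fun j => lt_of_le_of_ne (hl'.2 j) (h j).symm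
      have p2 : ∀ j, 0 < g v j (y - l) := fun j => h2 l hl'.1 hl'.2 j (p1 j)
      rw [phi, if_pos p2, phi, if_pos p1]; norm_num
  · intro l hl
    by_cases h : ∃ i, g v i (x - l) = 0
    · simp only [ι, dif_pos h]
      exact (fact l hl _ h.choose_spec).2.2.2.1
    · simp only [ι, dif_neg h]; exact hl
  · intro l hl
    by_cases h : ∃ i, g v i (x - l) = 0
    · have e : ι l hl = l + ww v h.choose := by simp only [ι, dif_pos h]
      set i := h.choose with hidef
      have hi : g v i (x - l) = 0 := h.choose_spec
      obtain ⟨a1, a2, a3, a4, a5⟩ := fact l hl i hi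
      obtain ⟨b1, b2, b3, b4, b5⟩ := fact _ a4 (i+5) a5
      have h' : ∃ i', g v i' (x - (l + ww v i)) = 0 := ⟨i + 5, a5⟩
      have e' : ∀ hh, ι (l + ww v i) hh = l + ww v i + ww v h'.choose := by
        intro hh; simp only [ι, dif_pos h']
      have hc : h'.choose = i + 5 := by
        by_contra hcon
        exact absurd h'.choose_spec (b2 _ hcon).ne'
      have e'' : ∀ z (hz : z ∈ H.LL x), z = l + ww v i → ι z hz = l := by
        intro z hz hzz
        subst hzz
        rw [e' hz, hc, H.ww_opp]; abel
      exact e'' _ (by rw [e]; exact a4) e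
    · have e : ∀ z (hz : z ∈ H.LL x), z = l → ι z hz = l := by
        intro z hz hzz
        subst hzz
        simp only [ι, dif_neg h]
      exact e _ (by rw [e l hl rfl]; exact hl) (e l hl rfl)

lemma GG_const (H : Dec v) (hr : ∀ i, Reg v i) : ∃ c : ℝ, ∀ x ∈ XX v, H.GG x = c := by
  have hpc : IsPathConnected (XX v) := by
    have := (XX_countable v).isPathConnected_compl_of_one_lt_rank (E := Pt) (by
      rw [rank_prod']; simp [one_add_one_eq_two])
    rwa [compl_compl] at this
  have : PreconnectedSpace (XX v) := isPreconnected_iff_preconnectedSpace.1 hpc.isConnected.isPreconnected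
  have hlc : IsLocallyConstant fun x : XX v => H.GG x := by
    rw [IsLocallyConstant.iff_eventually_eq]
    intro x
    exact continuous_subtype_val.continuousAt.eventually (H.loc_const hr x.2)
  obtain ⟨x0, hx0⟩ := hpc.nonempty
  exact ⟨H.GG x0, fun x hx => hlc.apply_eq_of_preconnectedSpace ⟨x, hx⟩ ⟨x0, hx0⟩⟩

lemma cnt_LL (H : Dec v) (x : Pt) : cnt (DPoly v) x = ((H.LL x).card : ℕ∞) := by
  rw [cnt, (inc_fin H.bounded_poly x).encard_eq_coe_toFinset_card]; rfl

open Classical in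
lemma cnt_int (H : Dec v) (x : Pt) :
    cnt (interior (DPoly v)) x = (((H.LL x).filter fun l => ∀ j, 0 < g v j (x - l)).card : ℕ∞) := by
  rw [cnt, ← Set.encard_coe_eq_coe_finsetCard]
  congr 1
  ext l
  rw [H.interior_poly]
  simp only [Finset.coe_filter, mem_LL]
  constructor
  · rintro ⟨a, b⟩; exact ⟨⟨a, fun j => (b j).le⟩, b⟩
  · rintro ⟨⟨a, _⟩, b⟩; exact ⟨a, b⟩

lemma phi_le (p : Pt) : phi v p ≤ 1 := by
  unfold phi; split_ifs <;> norm_num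
lemma phi_nonneg (p : Pt) : 0 ≤ phi v p := by
  unfold phi; split_ifs <;> norm_num

lemma GG_le (H : Dec v) (x : Pt) : H.GG x ≤ (H.LL x).card := by
  unfold GG
  calc _ ≤ ∑ l ∈ H.LL x, (1:ℝ) := Finset.sum_le_sum fun l _ => phi_le _
    _ = _ := by simp

open Classical in
lemma le_GG (H : Dec v) (x : Pt) :
    (((H.LL x).filter fun l => ∀ j, 0 < g v j (x - l)).card : ℝ) ≤ H.GG x := by
  unfold GG
  rw [Finset.card_filter]
  push_cast
  apply Finset.sum_le_sum
  intro l _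
  split_ifs with h
  · rw [phi, if_pos h]
  · exact phi_nonneg _

/-- sufficiency -/
lemma tiles (H : Dec v) (hr : ∀ i, Reg v i) {k : ℕ} (hA : area v = k) :
    (∀ p, (k : ℕ∞) ≤ cnt (DPoly v) p) ∧ (∀ p, cnt (interior (DPoly v)) p ≤ k) := by
  classical
  obtain ⟨c, hc⟩ := H.GG_const hr
  have hdense : Dense (XX v) := by
    have := (XX_countable v).dense_compl ℝ
    rwa [compl_compl] at this
  have hc0 : 0 ≤ c := by
    obtain ⟨x, hx⟩ := hdense.nonempty
    rw [← hc x hx]; exact Finset.sum_nonneg fun l _ => phi_nonneg _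
  have hvol := H.volume_poly
  have hae : ∀ᵐ x ∂(volume.restrict (cell 0)), x ∈ XX v := by
    apply ae_restrict_of_ae
    have : volume (XX v)ᶜ = 0 := (XX_countable v).measure_zero _
    exact this
  have hvi : volume (interior (DPoly v)) = volume (DPoly v) := by
    apply le_antisymm (measure_mono interior_subset)
    calc volume (DPoly v) ≤ volume (interior (DPoly v) ∪ frontier (DPoly v)) := measure_mono (by
            rw [← closure_eq_interior_union_frontier]
            exact subset_closure)
      _ ≤ volume (interior (DPoly v)) + volume (frontier (DPoly v)) := measure_union_le _ _
      _ = volume (interior (DPoly v)) := by rw [(convex_poly v).addHaar_frontier volume, add_zero]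
  have i1 : volume (DPoly v) ≤ ENNReal.ofReal c := by
    rw [← hvi, ← lint_cnt _ isOpen_interior.measurableSet]
    calc _ ≤ ∫⁻ x in cell 0, ENNReal.ofReal c := by
          apply lintegral_mono_ae
          filter_upwards [hae] with x hx
          rw [H.cnt_int, ← hc x hx]
          have := ENNReal.ofReal_le_ofReal (H.le_GG x)
          rw [ENNReal.ofReal_natCast] at this
          simpa using this
      _ = _ := by simp [cell_vol]
  have i2 : ENNReal.ofReal c ≤ volume (DPoly v) := by
    rw [← lint_cnt _ (closed_poly v).measurableSet]
    calc ENNReal.ofReal c = ∫⁻ x in cell 0, ENNReal.ofReal c := by simp [cell_vol]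
      _ ≤ _ := by
          apply lintegral_mono_ae
          filter_upwards [hae] with x hx
          rw [H.cnt_LL, ← hc x hx]
          have := ENNReal.ofReal_le_ofReal (H.GG_le x)
          rw [ENNReal.ofReal_natCast] at this
          simpa using this
  have hck : c = k := by
    have := le_antisymm i2 i1
    rw [hvol, hA] at this
    exact (ENNReal.ofReal_eq_ofReal_iff hc0 (by positivity)).1 this
  constructor
  · intro p
    obtain ⟨x, hx, hx'⟩ := hdense.exists_mem_open isOpen_interior
      ⟨p, mem_interior_iff_mem_nhds.2 (near H.bounded_poly (closed_poly v) p)⟩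
    have hx' := interior_subset hx'
    have : (k:ℝ) ≤ (H.LL x).card := by rw [← hck, ← hc x hx]; exact H.GG_le x
    have h2 : k ≤ (H.LL x).card := by exact_mod_cast this
    calc (k:ℕ∞) ≤ ((H.LL x).card : ℕ∞) := by exact_mod_cast h2
      _ = cnt (DPoly v) x := (H.cnt_LL x).symm
      _ ≤ cnt (DPoly v) p := encard_le_encard fun l hl => ⟨hl.1, hx' l hl.1 hl.2⟩
  · intro p
    obtain ⟨x, hx, hx'⟩ := hdense.exists_mem_open isOpen_interior
      ⟨p, mem_interior_iff_mem_nhds.2 (H.near_pos p)⟩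
    have hx' := interior_subset hx'
    have : (((H.LL x).filter fun l => ∀ j, 0 < g v j (x - l)).card : ℝ) ≤ k := by
      rw [← hck, ← hc x hx]; exact H.le_GG x
    have h2 : ((H.LL x).filter fun l => ∀ j, 0 < g v j (x - l)).card ≤ k := by exact_mod_cast this
    calc cnt (interior (DPoly v)) p ≤ cnt (interior (DPoly v)) x := by
          apply encard_le_encard
          rintro l ⟨hl, hl'⟩
          refine ⟨hl, ?_⟩
          have hm : p - l ∈ DPoly v := interior_subset hl'
          rw [H.interior_poly] at hl' ⊢
          exact fun j => hx' l hl hm j (hl' j)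
      _ = _ := H.cnt_int x
      _ ≤ k := by exact_mod_cast h2

end Dec

end Part9

section Part10
open Set Pointwise MeasureTheory Topology

lemma image_interior_affine (T : Pt ≃ᵃ[ℝ] Pt) (P : Set Pt) :
    interior (T '' P) = T '' interior P := by
  have := (AffineEquiv.toContinuousAffineEquiv T).toHomeomorph.image_interior P
  exact this.symm

lemma extreme_affine (T : Pt ≃ᵃ[ℝ] Pt) {P S : Set Pt} (h : IsExtreme ℝ P S) :
    IsExtreme ℝ (T '' P) (T '' S) := by
  refine ⟨Set.image_mono h.1, ?_⟩
  rintro _ ⟨a, ha, rfl⟩ _ ⟨b, hb, rfl⟩ _ ⟨x, hx, rfl⟩ hseg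
  have : x ∈ openSegment ℝ a b := by
    have e := image_openSegment ℝ (T : Pt →ᵃ[ℝ] Pt) a b
    simp only [AffineEquiv.coe_coe] at e
    rw [← e] at hseg
    obtain ⟨y, hy, hyx⟩ := hseg
    exact T.injective hyx ▸ hy
  exact Set.mem_image_of_mem _ (h.2 ha hb hx this)

lemma symm_image (T : Pt ≃ᵃ[ℝ] Pt) (P : Set Pt) : T.symm '' (T '' P) = P := by
  rw [Set.image_image]; simp

lemma extremePoints_affine (T : Pt ≃ᵃ[ℝ] Pt) (P : Set Pt) :
    Set.extremePoints ℝ (T '' P) = T '' Set.extremePoints ℝ P := by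
  have key : ∀ (T : Pt ≃ᵃ[ℝ] Pt) (P : Set Pt),
      T '' Set.extremePoints ℝ P ⊆ Set.extremePoints ℝ (T '' P) := by
    rintro T P _ ⟨x, hx, rfl⟩
    rw [← isExtreme_singleton] at hx ⊢
    simpa using extreme_affine T hx
  refine subset_antisymm ?_ (key T P)
  have h := Set.image_mono (f := T) (key T.symm (T '' P))
  rw [symm_image] at h
  have := symm_image T.symm (Set.extremePoints ℝ (T '' P))
  rw [show T.symm.symm = T from rfl] at this
  rwa [this] at h

lemma polygon_affine (T : Pt ≃ᵃ[ℝ] Pt) {P : Set Pt} {n : ℕ} (h : IsConvexPolygon P n) :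
    IsConvexPolygon (T '' P) n := by
  obtain ⟨h1, h2, h3, h4, h5, h6⟩ := h
  refine ⟨?_, ?_, ?_, ?_, ?_, ?_⟩
  · exact h1.affine_image (T : Pt →ᵃ[ℝ] Pt)
  · exact h2.image (AffineEquiv.toContinuousAffineEquiv T).continuous
  · rw [image_interior_affine]; exact h3.image _
  · rw [extremePoints_affine]; exact h4.image _
  · rw [extremePoints_affine, Set.ncard_image_of_injective _ T.injective, h5]
  · rw [extremePoints_affine]
    have := AffineMap.image_convexHull (T : Pt →ᵃ[ℝ] Pt) (Set.extremePoints ℝ P)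
    simp only [AffineEquiv.coe_coe] at this
    rw [← this, ← h6]

lemma edgeMid_affine (T : Pt ≃ᵃ[ℝ] Pt) (P : Set Pt) :
    edgeMidpoints (T '' P) = T '' edgeMidpoints P := by
  have key : ∀ (T : Pt ≃ᵃ[ℝ] Pt) (P : Set Pt),
      T '' edgeMidpoints P ⊆ edgeMidpoints (T '' P) := by
    rintro T P _ ⟨_, ⟨a, b, ⟨hab, hE⟩, rfl⟩, rfl⟩
    refine ⟨T a, T b, ⟨fun h => hab (T.injective h), ?_⟩, ?_⟩
    · have := extreme_affine T hE
      have e := image_segment ℝ (T : Pt →ᵃ[ℝ] Pt) a b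
      simp only [AffineEquiv.coe_coe] at e
      rwa [e] at this
    · exact (T : Pt →ᵃ[ℝ] Pt).map_midpoint a b
  refine subset_antisymm ?_ (key T P)
  have h := Set.image_mono (f := T) (key T.symm (T '' P))
  rw [symm_image] at h
  have := symm_image T.symm (edgeMidpoints (T '' P))
  rw [show T.symm.symm = T from rfl] at this
  rwa [this] at h

lemma inc_affine (T : Pt ≃ᵃ[ℝ] Pt) (K L : Set Pt) (p : Pt) :
    {l ∈ T.linear '' L | p - l ∈ T '' K}.encard = {l ∈ L | T.symm p - l ∈ K}.encard := by
  rw [← (T.linear.injective).encard_image {l ∈ L | T.symm p - l ∈ K}]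
  congr 1
  have key : ∀ l, p - T.linear l = T (T.symm p - l) := by
    intro l
    have := T.map_vadd (T.symm p) (-l)
    simp only [vadd_eq_add, map_neg, AffineEquiv.apply_symm_apply] at this
    rw [sub_eq_neg_add, sub_eq_neg_add, this]
  ext x
  constructor
  · rintro ⟨⟨l, hl, rfl⟩, hx⟩
    rw [key] at hx
    exact ⟨l, ⟨hl, (T.injective.mem_set_image).1 hx⟩, rfl⟩
  · rintro ⟨l, ⟨hl, h⟩, rfl⟩
    exact ⟨⟨l, hl, rfl⟩, by rw [key]; exact Set.mem_image_of_mem _ h⟩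

lemma tiling_affine (T : Pt ≃ᵃ[ℝ] Pt) {K L : Set Pt} {k : ℕ} (h : IsKFoldLatticeTiling K L k) :
    IsKFoldLatticeTiling (T '' K) (T.linear '' L) k := by
  obtain ⟨⟨B, rfl⟩, h1, h2⟩ := h
  refine ⟨⟨B.trans T.linear, ?_⟩, ?_, ?_⟩
  · rw [Set.image_image]; rfl
  · intro p; rw [inc_affine]; exact h1 _
  · intro p; rw [image_interior_affine, inc_affine]; exact h2 _

/-- an integer enumeration of the doubled points of `D2` -/
def UZ (i : ZMod 10) : ℤ × ℤ :=
  (![(1, -2), (3, -1), (4, 0), (3, 1), (1, 2), (-1, 2), (-3, 1), (-4, 0), (-3, -1), (-1, -2)] :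
    Fin 10 → ℤ × ℤ) i

def crZ (a b : ℤ × ℤ) : ℤ := a.1 * b.2 - a.2 * b.1

def U (i : ZMod 10) : Pt := ((UZ i).1, (UZ i).2)

lemma crU (i j : ZMod 10) : cr (U i) (U j) = (crZ (UZ i) (UZ j) : ℤ) := by
  simp [cr, crZ, U]

structure Cyc (u : ZMod 10 → Pt) : Prop where
  opp : ∀ i, u (i + 5) = -u i
  c1 : ∀ i, 0 < cr (u i) (u (i + 1))
  c2 : ∀ i, 0 < cr (u i) (u (i + 2))
  c3 : ∀ i, 0 < cr (u i) (u (i + 3))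
  c4 : ∀ i, 0 < cr (u i) (u (i + 4))

lemma cycU : Cyc U := by
  refine ⟨?_, ?_, ?_, ?_, ?_⟩
  · intro i
    have : ∀ i, UZ (i + 5) = - UZ i := by decide
    simp [U, this]
  · intro i; rw [crU]; exact_mod_cast (by decide : ∀ i, 0 < crZ (UZ i) (UZ (i + 1))) i
  · intro i; rw [crU]; exact_mod_cast (by decide : ∀ i, 0 < crZ (UZ i) (UZ (i + 2))) i
  · intro i; rw [crU]; exact_mod_cast (by decide : ∀ i, 0 < crZ (UZ i) (UZ (i + 3))) i
  · intro i; rw [crU]; exact_mod_cast (by decide : ∀ i, 0 < crZ (UZ i) (UZ (i + 4))) i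

lemma Cyc.sgn {u : ZMod 10 → Pt} (h : Cyc u) (i m : ZMod 10) (hm : 0 < cr (u i) (u (i + m))) :
    m = 1 ∨ m = 2 ∨ m = 3 ∨ m = 4 := by
  have o : ∀ j, i + (j + 5) = (i + j) + 5 := fun j => by ring
  have e6 : (6 : ZMod 10) = 1 + 5 := by decide
  have e7 : (7 : ZMod 10) = 2 + 5 := by decide
  have e8 : (8 : ZMod 10) = 3 + 5 := by decide
  have e9 : (9 : ZMod 10) = 4 + 5 := by decide
  have c1 := h.c1 i
  have c2 := h.c2 i
  have c3 := h.c3 i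
  have c4 := h.c4 i
  rcases zmod10_cases m with rfl | rfl | rfl | rfl | rfl | rfl | rfl | rfl | rfl | rfl
  · simp [cr] at hm; linarith
  · simp
  · simp
  · simp
  · simp
  · rw [h.opp] at hm; simp [cr] at hm; linarith
  · rw [e6, o, h.opp] at hm; simp [cr] at hm c1; linarith
  · rw [e7, o, h.opp] at hm; simp [cr] at hm c2; linarith
  · rw [e8, o, h.opp] at hm; simp [cr] at hm c3; linarith
  · rw [e9, o, h.opp] at hm; simp [cr] at hm c4; linarith

lemma Cyc.succ {u w : ZMod 10 → Pt} (hu : Cyc u) (hw : Cyc w) (hr : range w = range u)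
    (i j : ZMod 10) (hij : w i = u j) : w (i + 1) = u (j + 1) := by
  obtain ⟨a, ha⟩ : w (i + 1) ∈ range u := hr ▸ ⟨_, rfl⟩
  obtain ⟨b, hb⟩ : u (j + 1) ∈ range w := hr ▸ ⟨_, rfl⟩
  obtain ⟨m, rfl⟩ : ∃ m, a = j + m := ⟨a - j, by ring⟩
  obtain ⟨n, rfl⟩ : ∃ n, b = i + n := ⟨b - i, by ring⟩
  have hm := hu.sgn j m (by rw [ha, ← hij]; exact hw.c1 i)
  have hn := hw.sgn i n (by rw [hb, hij]; exact hu.c1 j)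
  by_cases h1 : m = 1
  · rw [← ha, h1]
  exfalso
  have p : 0 < cr (u (j + 1)) (u (j + m)) := by
    rcases hm with rfl | rfl | rfl | rfl
    · exact absurd rfl h1
    · have := hu.c1 (j + 1); rwa [add_assoc, show (1 : ZMod 10) + 1 = 2 by decide] at this
    · have := hu.c2 (j + 1); rwa [add_assoc, show (1 : ZMod 10) + 2 = 3 by decide] at this
    · have := hu.c3 (j + 1); rwa [add_assoc, show (1 : ZMod 10) + 3 = 4 by decide] at this
  have q : 0 ≤ cr (w (i + 1)) (w (i + n)) := by
    rcases hn with rfl | rfl | rfl | rfl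
    · simp only [cr]; apply le_of_eq; ring
    · have := (hw.c1 (i + 1)).le; rwa [add_assoc, show (1 : ZMod 10) + 1 = 2 by decide] at this
    · have := (hw.c2 (i + 1)).le; rwa [add_assoc, show (1 : ZMod 10) + 2 = 3 by decide] at this
    · have := (hw.c3 (i + 1)).le; rwa [add_assoc, show (1 : ZMod 10) + 3 = 4 by decide] at this
  rw [ha, ← hb] at p
  simp only [cr] at p q
  linarith

lemma Cyc.shift {u w : ZMod 10 → Pt} (hu : Cyc u) (hw : Cyc w) (hr : range w = range u) :
    ∃ i, w i = u 0 ∧ w (i + 1) = u 1 ∧ w (i + 2) = u 2 ∧ w (i + 3) = u 3 ∧ w (i + 4) = u 4 := by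
  obtain ⟨i, hi⟩ : u 0 ∈ range w := hr ▸ ⟨_, rfl⟩
  have s := hu.succ hw hr
  have h1 := s _ _ hi
  have h2 := s _ _ h1
  have h3 := s _ _ h2
  have h4 := s _ _ h3
  simp only [add_assoc, zero_add] at h1 h2 h3 h4
  exact ⟨i, hi, h1, h2, h3, h4⟩

lemma Dec.cyc {v : ZMod 10 → Pt} (H : Dec v) : Cyc (Dec.ww v) := by
  refine ⟨H.ww_opp, ?_, ?_, ?_, ?_⟩ <;> intro i
  · have a := H.ord1 i
    have b := H.ord2 i
    have c := H.ord1 (i + 1)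
    simp only [ww, cr, add_assoc] at *
    norm_num at *
    linarith
  · have a := H.ord2 i
    have b := H.ord3 i
    have c := H.ord1 (i + 1)
    have d := H.ord2 (i + 1)
    simp only [ww, cr, add_assoc] at *
    norm_num at *
    linarith
  · have a := H.ord3 i
    have b := H.ord4 i
    have c := H.ord2 (i + 1)
    have d := H.ord3 (i + 1)
    simp only [ww, cr, add_assoc] at *
    norm_num at *
    linarith
  · have a := H.ord4 i
    have b := H.opp i
    have c := H.ord3 (i + 1)
    have d := H.ord4 (i + 1)
    simp only [ww, cr, add_assoc] at *
    norm_num at *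
    rw [b] at *
    simp at *
    linarith

end Part10

section Part11
open Set Pointwise MeasureTheory Topology

lemma mid_ww (v : ZMod 10 → Pt) (i : ZMod 10) :
    midpoint ℝ (v i) (v (i + 1)) = (1/2 : ℝ) • Dec.ww v i := by
  rw [midpoint_eq_smul_add, Dec.ww]; norm_num

lemma range_half {u w : ZMod 10 → Pt} (h : range (fun i => (1/2 : ℝ) • w i) = range (fun i => (1/2 : ℝ) • u i)) :
    range w = range u := by
  have key : ∀ f : ZMod 10 → Pt, range f = (fun x : Pt => (2:ℝ) • x) '' range (fun i => (1/2 : ℝ) • f i) := by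
    intro f
    rw [← range_comp]
    congr 1; ext i <;> simp
  rw [key w, key u, h]

lemma range_ten {α : Type} (f : ZMod 10 → α) :
    range f = {f 0, f 1, f 2, f 3, f 4, f 5, f 6, f 7, f 8, f 9} := by
  ext x
  constructor
  · rintro ⟨i, rfl⟩
    rcases zmod10_cases i with rfl | rfl | rfl | rfl | rfl | rfl | rfl | rfl | rfl | rfl <;> simp
  · simp only [mem_insert_iff, mem_singleton_iff]
    rintro (rfl | rfl | rfl | rfl | rfl | rfl | rfl | rfl | rfl | rfl) <;> exact ⟨_, rfl⟩

lemma U0 : U 0 = (1, -2) := by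
  have : UZ 0 = (1, -2) := by decide
  simp [U, this]
lemma U1 : U 1 = (3, -1) := by
  have : UZ 1 = (3, -1) := by decide
  simp [U, this]
lemma U2 : U 2 = (4, 0) := by
  have : UZ 2 = (4, 0) := by decide
  simp [U, this]
lemma U3 : U 3 = (3, 1) := by
  have : UZ 3 = (3, 1) := by decide
  simp [U, this]
lemma U4 : U 4 = (1, 2) := by
  have : UZ 4 = (1, 2) := by decide
  simp [U, this]

lemma opp_five {u : ZMod 10 → Pt} (o : ∀ i, u (i + 5) = -u i) :
    u 5 = -u 0 ∧ u 6 = -u 1 ∧ u 7 = -u 2 ∧ u 8 = -u 3 ∧ u 9 = -u 4 :=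
  ⟨o 0, o 1, o 2, o 3, o 4⟩

lemma D2_eq : D2 = range (fun i => (1/2 : ℝ) • U i) := by
  obtain ⟨h5, h6, h7, h8, h9⟩ := opp_five cycU.opp
  rw [range_ten, h5, h6, h7, h8, h9, U0, U1, U2, U3, U4, D2]
  norm_num

/-- a rotated enumeration has the same range -/
lemma range_rot (w : ZMod 10 → Pt) (i : ZMod 10) : range w = range (fun j => w (i + j)) := by
  ext x
  constructor
  · rintro ⟨j, rfl⟩; exact ⟨j - i, by simp⟩
  · rintro ⟨j, rfl⟩; exact ⟨_, rfl⟩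

lemma equiv_of_cr {a b : Pt} (h : cr a b ≠ 0) : ∃ E : Pt ≃ₗ[ℝ] Pt, ∀ p, E p = p.1 • a + p.2 • b := by
  have hu : IsUnit (LinearMap.det (lin2 a b)) := by rw [lin2_det]; exact isUnit_iff_ne_zero.2 h
  refine ⟨LinearMap.equivOfIsUnitDet hu, fun p => ?_⟩
  rw [LinearMap.equivOfIsUnitDet_apply, lin2_apply]

lemma D2_of_cyc (w : ZMod 10 → Pt) (o : ∀ i, w (i + 5) = -w i) (i : ZMod 10)
    (h0 : w i = U 0) (h1 : w (i + 1) = U 1) (h2 : w (i + 2) = U 2) (h3 : w (i + 3) = U 3)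
    (h4 : w (i + 4) = U 4) : range (fun i => (1/2 : ℝ) • w i) = D2 := by
  have e : (fun j => w (i + j)) = U := by
    obtain ⟨h5, h6, h7, h8, h9⟩ := opp_five cycU.opp
    obtain ⟨k5, k6, k7, k8, k9⟩ := opp_five (u := fun j => w (i + j)) (fun j => by
      rw [← add_assoc, o])
    simp only [add_zero] at k5 k6 k7 k8 k9
    funext j
    rcases zmod10_cases j with rfl | rfl | rfl | rfl | rfl | rfl | rfl | rfl | rfl | rfl
    · simpa using h0
    · exact h1
    · exact h2
    · exact h3
    · exact h4
    · rw [k5, h5, h0]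
    · rw [k6, h6, h1]
    · rw [k7, h7, h2]
    · rw [k8, h8, h3]
    · rw [k9, h9, h4]
  rw [range_rot _ i, D2_eq]
  congr 1; funext j
  exact congrArg _ (congrFun e j)

/-- necessity, normalised -/
lemma coreA {P : Set Pt} (hP : IsConvexPolygon P 10) (hs : P = -P)
    (ht : IsKFoldLatticeTiling P IntLattice 6) :
    ∃ M : Pt ≃ₗ[ℝ] Pt, M '' edgeMidpoints P = D2 := by
  obtain ⟨v, H, rfl, hE⟩ := exists_dec hP hs
  obtain ⟨-, t1, t2⟩ := ht
  have hA : Dec.area v = 6 := by exact_mod_cast H.tiling_area t1 t2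
  have hr := H.all_reg (H.bolle t1 t2) hA.le
  obtain ⟨i, c1, c2, c3, c4, c5⟩ := H.classify_rot hr hA
  obtain ⟨E, hE1⟩ := equiv_of_cr (a := Dec.dd v i) (b := Dec.dd v (i + 1)) (by rw [c1]; norm_num)
  obtain ⟨F, hF⟩ := equiv_of_cr (a := (2, 1)) (b := (1, 1)) (by norm_num [cr])
  have hM : ∀ a b : ℝ, F (E.symm (a • Dec.dd v i + b • Dec.dd v (i + 1))) = (2 * a + b, a + b) := by
    intro a b
    have : E.symm (a • Dec.dd v i + b • Dec.dd v (i + 1)) = (a, b) := by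
      rw [LinearEquiv.symm_apply_eq, hE1]
    rw [this, hF]
    ext <;> simp [mul_comm]
  have d2 : Dec.dd v (i + 2) = (-2 : ℝ) • Dec.dd v i + (3 : ℝ) • Dec.dd v (i + 1) := by
    simp only [cr] at c1 c2 c3
    ext <;> simp
    · linear_combination (-(Dec.dd v (i+2)).1) * c1 + (-(Dec.dd v i).1) * c2 + (Dec.dd v (i+1)).1 * c3
    · linear_combination (-(Dec.dd v (i+2)).2) * c1 + (-(Dec.dd v i).2) * c2 + (Dec.dd v (i+1)).2 * c3
  have d3 : Dec.dd v (i + 3) = (-3 : ℝ) • Dec.dd v i + (4 : ℝ) • Dec.dd v (i + 1) := by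
    simp only [cr] at c1 c4 c5
    ext <;> simp
    · linear_combination (-(Dec.dd v (i+3)).1) * c1 + (-(Dec.dd v i).1) * c4 + (Dec.dd v (i+1)).1 * c5
    · linear_combination (-(Dec.dd v (i+3)).2) * c1 + (-(Dec.dd v i).2) * c4 + (Dec.dd v (i+1)).2 * c5
  have w0 : Dec.ww v i = (3 : ℝ) • Dec.dd v i + (-5 : ℝ) • Dec.dd v (i + 1) := by
    rw [H.ww_dd, d3]; module
  have w1 : Dec.ww v (i + 1) = (4 : ℝ) • Dec.dd v i + (-5 : ℝ) • Dec.dd v (i + 1) := by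
    rw [Dec.ww_succ v, w0]; module
  have w2 : Dec.ww v (i + 2) = (4 : ℝ) • Dec.dd v i + (-4 : ℝ) • Dec.dd v (i + 1) := by
    have := Dec.ww_succ v (i + 1)
    rw [add_assoc, one_add_one_eq_two] at this
    rw [this, w1]; module
  have w3 : Dec.ww v (i + 3) = (2 : ℝ) • Dec.dd v i + (-1 : ℝ) • Dec.dd v (i + 1) := by
    have := Dec.ww_succ v (i + 2)
    rw [add_assoc, show (2 : ZMod 10) + 1 = 3 by decide] at this
    rw [this, w2, d2]; module
  have w4 : Dec.ww v (i + 4) = (-1 : ℝ) • Dec.dd v i + (3 : ℝ) • Dec.dd v (i + 1) := by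
    have := Dec.ww_succ v (i + 3)
    rw [add_assoc, show (3 : ZMod 10) + 1 = 4 by decide] at this
    rw [this, w3, d3]; module
  refine ⟨E.symm.trans F, ?_⟩
  rw [H.edgeMid hE, ← range_comp]
  have e : (⇑(E.symm.trans F) ∘ fun i => midpoint ℝ (v i) (v (i + 1)))
      = fun i => (1/2 : ℝ) • F (E.symm (Dec.ww v i)) := by
    funext j
    simp only [Function.comp, mid_ww, LinearEquiv.trans_apply, map_smul]
  rw [e]
  apply D2_of_cyc (fun i => F (E.symm (Dec.ww v i))) (fun j => by rw [H.ww_opp]; simp) i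
  · rw [w0, hM, U0]; norm_num
  · rw [w1, hM, U1]; norm_num
  · rw [w2, hM, U2]; norm_num
  · rw [w3, hM, U3]; norm_num
  · rw [w4, hM, U4]; norm_num

lemma int_IsLattice : IsLattice IntLattice := ⟨LinearEquiv.refl ℝ Pt, (Set.image_id _).symm⟩

/-- sufficiency, normalised -/
lemma coreB {P : Set Pt} (hP : IsConvexPolygon P 10) (hs : P = -P) (hD : edgeMidpoints P = D2) :
    IsKFoldLatticeTiling P IntLattice 6 ∧ volume P = 6 := by
  obtain ⟨v, H, rfl, hE⟩ := exists_dec hP hs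
  rw [H.edgeMid hE, D2_eq] at hD
  simp only [mid_ww] at hD
  have hr := range_half hD
  have hreg : ∀ i, Dec.Reg v i := by
    intro i
    obtain ⟨j, hj⟩ : Dec.ww v i ∈ range U := hr ▸ ⟨i, rfl⟩
    exact ⟨(UZ j).1, (UZ j).2, hj.symm⟩
  obtain ⟨i, h0, h1, h2, h3, h4⟩ := cycU.shift H.cyc hr
  rw [U0] at h0
  rw [U1] at h1
  rw [U2] at h2
  rw [U3] at h3
  rw [U4] at h4
  have hA : Dec.area v = 6 := by
    rw [← H.ar_eq i]
    simp only [Dec.ww, add_assoc] at h0 h1 h2 h3 h4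
    norm_num at h0 h1 h2 h3 h4
    have v1 : v (i + 1) = (1, -2) - v i := by rw [← h0]; abel
    have v2 : v (i + 2) = (3, -1) - v (i + 1) := by rw [← h1]; abel
    have v3 : v (i + 3) = (4, 0) - v (i + 2) := by rw [← h2]; abel
    have v4 : v (i + 4) = (3, 1) - v (i + 3) := by rw [← h3]; abel
    have v5 : v (i + 5) = (1, 2) - v (i + 4) := by rw [← h4]; abel
    simp only [Dec.ar, S10, Dec.ed, add_assoc]
    norm_num
    rw [v5, v4, v3, v2, v1]
    simp only [cr, Prod.fst_sub, Prod.snd_sub]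
    ring
  have := H.tiles hreg (k := 6) (by rw [hA]; norm_num)
  refine ⟨⟨int_IsLattice, this.1, this.2⟩, ?_⟩
  rw [H.volume_poly, hA]; norm_num

lemma coreC {P : Set Pt} (hP : IsConvexPolygon P 10) (hs : P = -P) {k : ℕ} (hk : k ≤ 6)
    (ht : IsKFoldLatticeTiling P IntLattice k) :
    (∀ x ∈ edgeMidpoints P, (2 : ℝ) • x ∈ IntLattice) ∧ volume P = k := by
  obtain ⟨v, H, rfl, hE⟩ := exists_dec hP hs
  obtain ⟨-, t1, t2⟩ := ht
  have hA : Dec.area v = k := H.tiling_area t1 t2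
  have hr := H.all_reg (H.bolle t1 t2) (by rw [hA]; exact_mod_cast hk)
  refine ⟨?_, ?_⟩
  · rw [H.edgeMid hE]
    rintro _ ⟨i, rfl⟩
    simp only [mid_ww]
    rw [smul_smul]; norm_num
    exact hr i
  · rw [H.volume_poly, hA]; simp

lemma D1_D2 : ∃ N : Pt ≃ₗ[ℝ] Pt, N '' D1 = D2 := by
  obtain ⟨F, hF⟩ := equiv_of_cr (a := (-1, 0)) (b := (1, -1)) (by norm_num [cr])
  refine ⟨F, ?_⟩
  simp only [D1, D2, Set.image_insert_eq, Set.image_singleton, hF]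
  norm_num
  ext x
  simp only [mem_insert_iff, mem_singleton_iff]
  tauto

end Part11

section Part12
open Set Pointwise MeasureTheory Topology

lemma neg_linear (M : Pt ≃ₗ[ℝ] Pt) {P : Set Pt} (h : P = -P) : M '' P = -(M '' P) := by
  conv_lhs => rw [h]
  ext x
  simp only [Set.mem_neg, Set.mem_image]
  constructor
  · rintro ⟨y, hy, rfl⟩; exact ⟨-y, hy, by simp⟩
  · rintro ⟨y, hy, e⟩; exact ⟨-y, by simpa using hy, by rw [map_neg, e, neg_neg]⟩

lemma coe_lin (M : Pt ≃ₗ[ℝ] Pt) : (⇑M.toAffineEquiv : Pt → Pt) = M := rfl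

lemma lin_symm_image (M : Pt ≃ₗ[ℝ] Pt) (P : Set Pt) : M.symm '' (M '' P) = P := by
  rw [Set.image_image]; simp

/-- a decagon with midpoint set `D2` has no smaller tilings -/
lemma no_small {Q : Set Pt} (hQ : IsConvexPolygon Q 10) (hs : Q = -Q) (hD : edgeMidpoints Q = D2)
    {k : ℕ} (h0 : 0 < k) (hk : k < 6) {L : Set Pt} (ht : IsKFoldLatticeTiling Q L k) : False := by
  obtain ⟨B, rfl⟩ := ht.1
  have ht' := tiling_affine B.symm.toAffineEquiv ht
  rw [show B.symm.toAffineEquiv.linear = B.symm from rfl, lin_symm_image, coe_lin] at ht'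
  have hQ' := polygon_affine B.symm.toAffineEquiv hQ
  have hm := edgeMid_affine B.symm.toAffineEquiv Q
  rw [coe_lin] at hQ' hm
  obtain ⟨h1, h2⟩ := coreC hQ' (neg_linear B.symm hs) hk.le ht'
  rw [hm, hD] at h1
  have hv := (coreB hQ hs hD).2
  have hI : ∀ x ∈ D2, B.symm ((2 : ℝ) • x) ∈ IntLattice := by
    intro x hx
    rw [map_smul]; exact h1 _ (Set.mem_image_of_mem _ hx)
  have a1 := hI (2, 0) (by simp [D2])
  have a2 := hI (3/2, 1/2) (by simp [D2])
  have a3 := hI (1/2, 1) (by simp [D2])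
  set e1 := B.symm (1, 0) with he1
  set e2 := B.symm (0, 1) with he2
  have lin : ∀ p : Pt, B.symm p = p.1 • e1 + p.2 • e2 := by
    intro p
    rw [he1, he2, ← map_smul, ← map_smul, ← map_add]
    congr 1; ext <;> simp
  have g1 : e1 ∈ IntLattice := by
    have := lat_sub (lat_add (lat_sub a2 a1) (lat_sub a2 a1)) (lat_sub a3 a1)
    convert this using 1
    simp only [lin]
    ext <;> simp <;> ring
  have g2 : e2 ∈ IntLattice := by
    have := lat_add (lat_sub a2 a1) g1
    convert this using 1
    simp only [lin]
    ext <;> simp <;> ring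
  obtain ⟨n, hn⟩ := lat_cr g1 g2
  have hdet : LinearMap.det (B.symm : Pt →ₗ[ℝ] Pt) = n := by
    have : (B.symm : Pt →ₗ[ℝ] Pt) = lin2 e1 e2 := by
      ext1 <;> ext <;> simp [lin2_apply, he1, he2]
    rw [this, lin2_det, hn]
  have hn0 : n ≠ 0 := by
    rintro rfl
    have := LinearEquiv.isUnit_det' B.symm
    rw [hdet] at this; simp at this
  have hvol := Measure.addHaar_image_linearMap volume (B.symm : Pt →ₗ[ℝ] Pt) Q
  rw [hdet, hv] at hvol
  have hvol' : (k : ENNReal) = ENNReal.ofReal |(n : ℝ)| * 6 := by rw [← h2, ← hvol]; rfl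
  have hn1 : (1 : ℝ) ≤ |(n : ℝ)| := by exact_mod_cast Int.one_le_abs hn0
  have : (6 : ENNReal) ≤ k := by
    rw [hvol']
    calc (6 : ENNReal) = 1 * 6 := by simp
      _ ≤ _ := by gcongr; exact ENNReal.one_le_ofReal.2 hn1
  have : 6 ≤ k := by exact_mod_cast this
  omega


end Part12

/-- a centrally symmetric convex decagon `P` satisfies `τ*(P) = 6` if and only if
some invertible affine image of `P` is centered at the origin and has edge midpoint set `D₁`
or `D₂`. -/
theorem decagon_sixfold_iff (P : Set Pt) (hP : IsConvexPolygon P 10)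
    (hsym : CentrallySymmetric P) :
    ((∃ L : Set Pt, IsKFoldLatticeTiling P L 6) ∧
      ∀ k : ℕ, 0 < k → k < 6 → ¬∃ L : Set Pt, IsKFoldLatticeTiling P L k) ↔
    (∃ T : Pt ≃ᵃ[ℝ] Pt, T '' P = -(T '' P) ∧
      (edgeMidpoints (T '' P) = D1 ∨ edgeMidpoints (T '' P) = D2)) := by
  constructor
  · rintro ⟨⟨L, hL⟩, -⟩
    obtain ⟨c, hc⟩ := hsym
    obtain ⟨B, rfl⟩ := hL.1
    let T0 : Pt ≃ᵃ[ℝ] Pt := (AffineEquiv.constVAdd ℝ Pt (-c)).trans B.symm.toAffineEquiv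
    have hT0 : ∀ x, T0 x = B.symm (-c + x) := fun x => rfl
    have ht := tiling_affine T0 hL
    have hlin : T0.linear = B.symm := by
      ext1 x
      rfl
    rw [hlin, lin_symm_image] at ht
    have hs : T0 '' P = -(T0 '' P) := by
      have key : ∀ x ∈ P, -(T0 x) ∈ T0 '' P := by
        intro x hx
        refine ⟨c + c - x, (hc x).1 hx, ?_⟩
        rw [hT0, hT0, ← map_neg]
        congr 1; abel
      ext y
      constructor
      · rintro ⟨x, hx, rfl⟩; exact key x hx
      · rintro ⟨x, hx, e⟩
        have := key x hx
        rwa [e, neg_neg] at this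
    have hp := polygon_affine T0 hP
    obtain ⟨M, hM⟩ := coreA hp hs ht
    have e : (T0.trans M.toAffineEquiv) '' P = M '' (T0 '' P) := by
      rw [Set.image_image]; rfl
    refine ⟨T0.trans M.toAffineEquiv, ?_, Or.inr ?_⟩
    · rw [e]; exact neg_linear M hs
    · rw [e, ← hM]; exact edgeMid_affine M.toAffineEquiv _
  · intro h
    obtain ⟨T, hs, hD⟩ : ∃ T : Pt ≃ᵃ[ℝ] Pt, T '' P = -(T '' P) ∧ edgeMidpoints (T '' P) = D2 := by
      obtain ⟨T, hs, hD | hD⟩ := h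
      · obtain ⟨N, hN⟩ := D1_D2
        have e : (T.trans N.toAffineEquiv) '' P = N '' (T '' P) := by
          rw [Set.image_image]; rfl
        refine ⟨T.trans N.toAffineEquiv, ?_, ?_⟩
        · rw [e]; exact neg_linear N hs
        · rw [e, ← hN, ← hD]; exact edgeMid_affine N.toAffineEquiv _
      · exact ⟨T, hs, hD⟩
    have hQ := polygon_affine T hP
    refine ⟨⟨T.symm.linear '' IntLattice, ?_⟩, ?_⟩
    · have := tiling_affine T.symm (coreB hQ hs hD).1
      rwa [symm_image] at this
    · rintro k h0 hk ⟨L, hL⟩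
      exact no_small hQ hs hD h0 hk (tiling_affine T hL)
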